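/- arXiv:1911.11045 — 2 statements merged into one kernel-verified Lean document; each statement's English description precedes it below -/
import Mathlib

section
/- Let A and B be disjoint sets of boxes of T_0 and let x_0 be a box of T_0 not in A ∪ B. Then in the group algebra ℂ𝔖_d one has ∑_{σ∈𝔖_{A∪{x_0}∪B}} σ = ∑_{a∈A∪{x_0}} τ_{x_0,a}·(∑_{σ∈𝔖_{A∪B}} σ) + ∑_{b∈B} (∑_{σ∈𝔖_{(A∪{x_0}∪B)∖{b}}} σ)·τ_{x_0,b}. -/
/-!
Formalization of definitions from "Pieri inclusions" (arXiv:1911.11045).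

Cells `(r, j)` have row index `r` (counted from the *top*, `0`-based; so a cell is
geometrically *lower* than another iff its row index is *larger*) and column index `j`
(`0`-based).  A shape is a finite set `K` of cells; in the intended applications `K` is the
set of cells of a Young diagram (possibly with some boxes removed).  Blocks of a partition
are recovered as the (automatically contiguous) groups of rows of equal width.
-/

open scoped TensorProduct Classical

noncomputable section

namespace PieriPaper

/-! ### Shapes, tableaux, Garnir relations -/

/-- A cell `(r, j)`: row `r` (from the top, `0`-based), column `j` (`0`-based). -/
abbrev Cell : Type := ℕ × ℕ

/-- The boxes of the shape given by a finite set `K` of cells. -/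
abbrev BoxOf (K : Finset Cell) : Type := {c : Cell // c ∈ K}

/-- Tableaux of shape `K` with entries in `Fin n` (representing `{1, …, n}`). -/
abbrev Tab (K : Finset Cell) (n : ℕ) : Type := BoxOf K → Fin n

/-- `ℱ_{K,n}`: the free complex vector space on the set of tableaux of shape `K`. -/
abbrev FreeT (K : Finset Cell) (n : ℕ) : Type := Tab K n →₀ ℂ

/-- The number of boxes of `K` in row `r` (the width of row `r`). -/
def rowWidth (K : Finset Cell) (r : ℕ) : ℕ := (K.filter fun c => c.1 = r).card

/-- The set of indices of nonempty rows of `K`. -/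
def rowsOf (K : Finset Cell) : Finset ℕ := K.image Prod.fst

/-- The set of boxes of `K` lying in row `r`. -/
def rowBoxes (K : Finset Cell) (r : ℕ) : Finset (BoxOf K) :=
  Finset.univ.filter fun b => b.val.1 = r

/-- Action of a permutation of the boxes on tableaux: `(σ · T) x = T (σ⁻¹ x)`. -/
def permAct {K : Finset Cell} {n : ℕ} (σ : Equiv.Perm (BoxOf K)) (T : Tab K n) : Tab K n :=
  fun x => T (σ⁻¹ x)

/-- The linear extension of the permutation action to `ℱ_{K,n}`. -/
def permL (K : Finset Cell) (n : ℕ) (σ : Equiv.Perm (BoxOf K)) : FreeT K n →ₗ[ℂ] FreeT K n :=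
  Finsupp.lift (FreeT K n) ℂ (Tab K n) fun T => Finsupp.single (permAct σ T) 1

/-- `w_A`: the maximum width of a row meeting `A`. -/
def wA (K : Finset Cell) (A : Finset (BoxOf K)) : ℕ := A.sup fun x => rowWidth K x.val.1

/-- `𝔖_A`: permutations preserving `A` and fixing every box outside `A`. -/
def SA {K : Finset Cell} (A : Finset (BoxOf K)) : Finset (Equiv.Perm (BoxOf K)) :=
  Finset.univ.filter fun σ => ∀ x, x ∉ A → σ x = x

/-- The Garnir operator `G_A` applied to a tableau `T`. -/
def garnir {K : Finset Cell} {n : ℕ} (A : Finset (BoxOf K)) (T : Tab K n) : FreeT K n :=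
  ∑ σ ∈ SA A, Finsupp.single (permAct σ T) 1

/-- The linear extension of the Garnir operator `G_A` to `ℱ_{K,n}`. -/
def garnirL (K : Finset Cell) (n : ℕ) (A : Finset (BoxOf K)) : FreeT K n →ₗ[ℂ] FreeT K n :=
  Finsupp.lift (FreeT K n) ℂ (Tab K n) fun T => garnir A T

/-- Two tableaux agree up to permutations of the entries within rows. -/
def RowEquiv {K : Finset Cell} {n : ℕ} (T₁ T₂ : Tab K n) : Prop :=
  ∃ σ : Equiv.Perm (BoxOf K), (∀ x, (σ x).val.1 = x.val.1) ∧ T₂ = permAct σ T₁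

/-- The span of the row-permutation differences `T₁ - T₂`. -/
def rowSpan (K : Finset Cell) (n : ℕ) : Submodule ℂ (FreeT K n) :=
  Submodule.span ℂ
    {z | ∃ T₁ T₂ : Tab K n, RowEquiv T₁ T₂ ∧ z = Finsupp.single T₁ 1 - Finsupp.single T₂ 1}

/-- `R_{K,n}`: the subspace of relations, spanned by row-permutation differences and
Garnir elements `G_A T` for `|A| > w_A`. -/
def Rmod (K : Finset Cell) (n : ℕ) : Submodule ℂ (FreeT K n) :=
  Submodule.span ℂ
    ({z | ∃ T₁ T₂ : Tab K n, RowEquiv T₁ T₂ ∧ z = Finsupp.single T₁ 1 - Finsupp.single T₂ 1} ∪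
      {z | ∃ (A : Finset (BoxOf K)) (T : Tab K n), wA K A < A.card ∧ z = garnir A T})

/-- The standard basis vector `e_i` of `V = ℂⁿ`. -/
def stdv (n : ℕ) (i : Fin n) : Fin n → ℂ := Pi.single i 1

/-- The action of a matrix `g` on `ℱ_{K,n}`:
`g · T = ∑_{T'} (∏_x g_{T'(x), T(x)}) T'`. -/
def glAct (K : Finset Cell) (n : ℕ) (g : Matrix (Fin n) (Fin n) ℂ) :
    FreeT K n →ₗ[ℂ] FreeT K n :=
  Finsupp.lift (FreeT K n) ℂ (Tab K n) fun T =>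
    ∑ T' : Tab K n, (∏ x : BoxOf K, g (T' x) (T x)) • Finsupp.single T' (1 : ℂ)

/-! ### Group algebra elements -/

/-- The element `∑_{σ ∈ 𝔖_A} σ` of the group algebra `ℂ𝔖_d`. -/
def sumSA {K : Finset Cell} (A : Finset (BoxOf K)) : MonoidAlgebra ℂ (Equiv.Perm (BoxOf K)) :=
  ∑ σ ∈ SA A, MonoidAlgebra.of ℂ (Equiv.Perm (BoxOf K)) σ

/-- The permutations in `𝔖_{C ∪ {x}}` sending `x` to `c` are the products `τ_{x,c} σ` with
`σ ∈ 𝔖_C`. -/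
theorem sum_filter_SA_insert_eq_swap_mul {K : Finset Cell} {C : Finset (BoxOf K)} {x c : BoxOf K}
    (hx : x ∉ C) (hc : c ∈ insert x C) :
    ∑ σ ∈ (SA (insert x C)).filter (fun σ => σ x = c),
        MonoidAlgebra.of ℂ (Equiv.Perm (BoxOf K)) σ =
      MonoidAlgebra.of ℂ (Equiv.Perm (BoxOf K)) (Equiv.swap x c) * sumSA C := by
  rw [sumSA, Finset.mul_sum]
  refine Finset.sum_bij' (fun σ _ => Equiv.swap x c * σ) (fun σ _ => Equiv.swap x c * σ)
    ?_ ?_ ?_ ?_ ?_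
  · intro σ hσ
    simp only [SA, Finset.mem_filter, Finset.mem_univ, true_and, Finset.mem_insert,
      Equiv.Perm.mul_apply] at hσ hc ⊢
    intro y hy
    by_cases hyx : y = x
    · rw [hyx, hσ.2, Equiv.swap_apply_right]
    · rw [hσ.1 y (by tauto), Equiv.swap_apply_of_ne_of_ne hyx]
      rintro rfl
      tauto
  · intro σ hσ
    simp only [SA, Finset.mem_filter, Finset.mem_univ, true_and, Finset.mem_insert,
      Equiv.Perm.mul_apply] at hσ hc ⊢
    refine ⟨fun y hy => ?_, by rw [hσ x hx, Equiv.swap_apply_left]⟩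
    rw [hσ y (by tauto), Equiv.swap_apply_of_ne_of_ne (by tauto)]
    rintro rfl
    tauto
  · intro σ _
    simp
  · intro σ _
    simp
  · intro σ _
    rw [← map_mul, Equiv.swap_mul_self_mul]

/-- The permutations in `𝔖_C` sending `x` to `b` are the products `σ τ_{x,b}` with
`σ ∈ 𝔖_{C ∖ {b}}`. -/
theorem sum_filter_SA_eq_mul_swap {K : Finset Cell} {C : Finset (BoxOf K)} {x b : BoxOf K}
    (hx : x ∈ C) (hb : b ∈ C) :
    ∑ σ ∈ (SA C).filter (fun σ => σ x = b), MonoidAlgebra.of ℂ (Equiv.Perm (BoxOf K)) σ =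
      sumSA (C.erase b) * MonoidAlgebra.of ℂ (Equiv.Perm (BoxOf K)) (Equiv.swap x b) := by
  rw [sumSA, Finset.sum_mul]
  refine Finset.sum_bij' (fun σ _ => σ * Equiv.swap x b) (fun σ _ => σ * Equiv.swap x b)
    ?_ ?_ ?_ ?_ ?_
  · intro σ hσ
    simp only [SA, Finset.mem_filter, Finset.mem_univ, true_and, Finset.mem_erase,
      Equiv.Perm.mul_apply] at hσ ⊢
    intro y hy
    by_cases hyb : y = b
    · rw [hyb, Equiv.swap_apply_right, hσ.2]
    · have hyC : y ∉ C := by tauto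
      rw [Equiv.swap_apply_of_ne_of_ne (ne_of_mem_of_not_mem hx hyC).symm hyb, hσ.1 y hyC]
  · intro σ hσ
    simp only [SA, Finset.mem_filter, Finset.mem_univ, true_and, Finset.mem_erase,
      Equiv.Perm.mul_apply] at hσ ⊢
    refine ⟨fun y hy => ?_, by rw [Equiv.swap_apply_left, hσ b (by tauto)]⟩
    rw [Equiv.swap_apply_of_ne_of_ne (ne_of_mem_of_not_mem hx hy).symm
      (ne_of_mem_of_not_mem hb hy).symm,
      hσ y (by tauto)]
  · intro σ _
    simp [mul_assoc]
  · intro σ _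
    simp [mul_assoc]
  · intro σ _
    rw [← map_mul, mul_assoc, Equiv.swap_mul_self, mul_one]

/-- A permutation in `𝔖_C` maps `C` to itself. -/
theorem apply_mem_of_mem_SA {K : Finset Cell} {C : Finset (BoxOf K)} {σ : Equiv.Perm (BoxOf K)}
    (hσ : σ ∈ SA C) {x : BoxOf K} (hx : x ∈ C) : σ x ∈ C := by
  simp only [SA, Finset.mem_filter, Finset.mem_univ, true_and] at hσ
  by_contra h
  exact h ((σ.injective (hσ _ h)).symm ▸ hx)

/-- For disjoint sets `A`, `B` of boxes of `T₀` and a box `x₀ ∉ A ∪ B`,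
in the group algebra `ℂ𝔖_d` one has
`∑_{σ∈𝔖_{A∪{x₀}∪B}} σ = ∑_{a∈A∪{x₀}} τ_{x₀,a}·(∑_{σ∈𝔖_{A∪B}} σ)
  + ∑_{b∈B} (∑_{σ∈𝔖_{(A∪{x₀}∪B)∖{b}}} σ)·τ_{x₀,b}`. -/
theorem statement3 (μ : YoungDiagram) (A B : Finset (BoxOf μ.cells)) (hAB : Disjoint A B)
    (x₀ : BoxOf μ.cells) (hx : x₀ ∉ A ∪ B) :
    sumSA (insert x₀ (A ∪ B)) =
      (∑ a ∈ insert x₀ A,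
        MonoidAlgebra.of ℂ (Equiv.Perm (BoxOf μ.cells)) (Equiv.swap x₀ a) * sumSA (A ∪ B)) +
      ∑ b ∈ B,
        sumSA ((insert x₀ (A ∪ B)).erase b) *
          MonoidAlgebra.of ℂ (Equiv.Perm (BoxOf μ.cells)) (Equiv.swap x₀ b) := by
  have hdisj : Disjoint (insert x₀ A) B := by
    rw [Finset.disjoint_insert_left]
    exact ⟨fun h => hx (Finset.mem_union_right A h), hAB⟩
  have hC : insert x₀ (A ∪ B) = insert x₀ A ∪ B := (Finset.insert_union x₀ A B).symm
  conv_lhs => rw [sumSA, ← Finset.sum_fiberwise_of_maps_to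
    (fun σ hσ => apply_mem_of_mem_SA hσ (Finset.mem_insert_self x₀ (A ∪ B)))]
  conv_lhs => rw [Finset.sum_congr hC (fun _ _ => rfl), Finset.sum_union hdisj]
  congr 1
  · refine Finset.sum_congr rfl fun a ha => sum_filter_SA_insert_eq_swap_mul hx ?_
    rw [hC]
    exact Finset.mem_union_left B ha
  · refine Finset.sum_congr rfl fun b hb =>
      sum_filter_SA_eq_mul_swap (Finset.mem_insert_self x₀ (A ∪ B)) ?_
    rw [hC]
    exact Finset.mem_union_right _ hb

end PieriPaper
end
end

section
/- The map Φ_1 : ℱ_{λ,n} → V ⊗ ℱ_{λ∖X,n} commutes with the GL_n(ℂ)-actions (Φ_1(g·T) = g·Φ_1(T) for all g ∈ GL_n(ℂ) and T ∈ ℱ_{λ,n}) and satisfies Φ_1(R_{λ,n}) ⊆ V ⊗ R_{λ∖X,n}; hence Φ_1 descends to a GL_n(ℂ)-equivariant linear map ℱ_{λ,n}/R_{λ,n} → V ⊗ (ℱ_{λ∖X,n}/R_{λ∖X,n}), i.e. a GL_n(ℂ)-map S_λ(V) → V ⊗ S_{λ∖X}(V) under the identifications of these quotients with the Schur–Weyl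 modules. -/
/-!
Formalization of definitions from "Pieri inclusions" (arXiv:1911.11045).

Cells `(r, j)` have row index `r` (counted from the *top*, `0`-based; so a cell is
geometrically *lower* than another iff its row index is *larger*) and column index `j`
(`0`-based).  A shape is a finite set `K` of cells; in the intended applications `K` is the
set of cells of a Young diagram (possibly with some boxes removed).  Blocks of a partition
are recovered as the (automatically contiguous) groups of rows of equal width.
-/

open scoped TensorProduct Classical

noncomputable section

namespace PieriPaper

/-! ### Removal sets -/

/-- A removal set of `m` boxes `x_1 < x_2 < ⋯ < x_m` for the shape `K`: each `x_k` is the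
rightmost box of its row, `x_1` is geometrically lowest (largest top-row-index), … , `x_m`
highest, and removing all of them leaves a Young-diagram shape (a lower set). -/
structure RemovalOn (K : Finset Cell) (m : ℕ) where
  box : Fin m → Cell
  mem : ∀ k, box k ∈ K
  lastCol : ∀ k, (box k).2 + 1 = rowWidth K (box k).1
  rows_anti : StrictAnti fun k => (box k).1
  lower : IsLowerSet (↑(K.filter fun c => ∀ i : Fin m, (i : ℕ) < m → c ≠ box i) : Set Cell)

/-- The shape obtained from `K` by removing the first `k` boxes `x_1, …, x_k` of `X`. -/
def keptUpTo {K : Finset Cell} {m : ℕ} (X : RemovalOn K m) (k : ℕ) : Finset Cell :=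
  K.filter fun c => ∀ i : Fin m, (i : ℕ) < k → c ≠ X.box i

/-- `λ ∖ X`: the shape obtained by removing all the boxes of `X`. -/
abbrev RemovalOn.kept {K : Finset Cell} {m : ℕ} (X : RemovalOn K m) : Finset Cell := keptUpTo X m

lemma keptUpTo_subset {K : Finset Cell} {m : ℕ} (X : RemovalOn K m) (k : ℕ) :
    keptUpTo X k ⊆ K := Finset.filter_subset _ _

lemma kept_subset {K : Finset Cell} {m : ℕ} (X : RemovalOn K m) : X.kept ⊆ K :=
  Finset.filter_subset _ _

lemma keptUpTo_zero {K : Finset Cell} {m : ℕ} (X : RemovalOn K m) : K = keptUpTo X 0 :=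
  (Finset.filter_true_of_mem fun _ _ => fun _ hi => absurd hi (Nat.not_lt_zero _)).symm

/-! ### Paths -/

/-- The boxes of `K` together with `m` extra boxes `y_1, …, y_m` attached above the shape. -/
abbrev PB (K : Finset Cell) (m : ℕ) : Type := BoxOf K ⊕ Fin m

/-- Comparison value of a box: a box is geometrically weakly lower than another iff its
`lowVal` is larger.  The extra boxes `y_1, y_2, …` get values `-1, -2, …` (above the shape,
with `y_{i+1}` above `y_i`). -/
def lowVal {K : Finset Cell} {m : ℕ} : PB K m → ℤ
  | Sum.inl b => (b.val.1 : ℤ)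
  | Sum.inr i => -1 - (i : ℤ)

/-- An evacuation route starting at the block whose bottom row is `r₁`: it contains a box in
row `r₁`, at most one box per row, and skips no row within a block (blocks being the groups
of rows of equal width). -/
structure IsEvacRoute (K : Finset Cell) (r₁ : ℕ) (R : Finset (BoxOf K)) : Prop where
  start : ∃ b ∈ R, b.val.1 = r₁
  one_per_row : ∀ b ∈ R, ∀ b' ∈ R, b.val.1 = b'.val.1 → b = b'
  no_skip : ∀ b ∈ R, ∀ r' : ℕ, b.val.1 < r' → rowWidth K r' = rowWidth K b.val.1 →
    ∃ b' ∈ R, b'.val.1 = r'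

/-- The orbit `R_i` of `x_i` under iteration of `P`. -/
def orb {K : Finset Cell} {m : ℕ} (X : RemovalOn K m) (P : PB K m → PB K m) (i : Fin m) :
    Set (PB K m) := {z | ∃ j : ℕ, P^[j] (Sum.inl ⟨X.box i, X.mem i⟩) = z}

/-- The orbit of `x_i` meets the block (of the original shape) of width `w`. -/
def meetsBlock {K : Finset Cell} {m : ℕ} (X : RemovalOn K m) (P : PB K m → PB K m)
    (i : Fin m) (w : ℕ) : Prop :=
  ∃ c : BoxOf K, Sum.inl c ∈ orb X P i ∧ rowWidth K c.val.1 = w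

/-- `P` together with the evacuation route `R` is an `m`-path removing `X`:
see Section 4.2 of the paper. -/
structure IsMPath {K : Finset Cell} {m : ℕ} [NeZero m] (X : RemovalOn K m)
    (P : PB K m → PB K m) (R : Finset (BoxOf K)) : Prop where
  /-- the route starts at the block of `x₁` -/
  route : IsEvacRoute K (X.box 0).1 R
  /-- `P` is geometrically (weakly) increasing -/
  mono : ∀ z, lowVal (P z) ≤ lowVal z
  /-- and strictly increasing on the route -/
  strict_on_route : ∀ b ∈ R, lowVal (P (Sum.inl b)) < (b.val.1 : ℤ)
  /-- `y_i` belongs to the orbit of `x_i` -/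
  y_mem : ∀ i, Sum.inr i ∈ orb X P i
  /-- `R ∪ X ∪ Y` is the union of the orbits -/
  orb_union : (⋃ i, orb X P i) =
    {z : PB K m | (∃ b ∈ R, z = Sum.inl b) ∨ (∃ i, z = Sum.inl ⟨X.box i, X.mem i⟩) ∨
      ∃ i, z = Sum.inr i}
  /-- and the union is disjoint -/
  orb_disjoint : ∀ i j, i ≠ j → Disjoint (orb X P i) (orb X P j)
  /-- if `k` distinct orbits meet a block, then (up to relabeling) the `j`-th of them meets
  the `j`-th row from the bottom of the block, for `j = 0, …, k-1` -/
  interlace : ∀ w : ℕ, 0 < w → ∃ g : Fin m → ℕ,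
    Set.InjOn g {i | meetsBlock X P i w} ∧
    ∀ i, meetsBlock X P i w →
      g i < Set.ncard {j | meetsBlock X P j w} ∧
      ∃ c : BoxOf K, Sum.inl c ∈ orb X P i ∧ rowWidth K c.val.1 = w ∧
        ((rowsOf K).filter fun r => c.val.1 < r ∧ rowWidth K r = w).card = g i
  /-- `P` preserves row order within blocks on the route -/
  row_order : ∀ b ∈ R, ∀ b' ∈ R, ∀ c c' : BoxOf K,
    rowWidth K b.val.1 = rowWidth K b'.val.1 → b'.val.1 < b.val.1 →
    P (Sum.inl b) = Sum.inl c → P (Sum.inl b') = Sum.inl c' →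
    rowWidth K c.val.1 = rowWidth K b.val.1 → rowWidth K c'.val.1 = rowWidth K b.val.1 →
    c'.val.1 < c.val.1
  /-- `P` fixes the extra boxes -/
  fix_y : ∀ i, P (Sum.inr i) = Sum.inr i
  /-- `P` fixes every box outside `R ∪ X` -/
  fix_out : ∀ b : BoxOf K, b ∉ R → (∀ i, b.val ≠ X.box i) → P (Sum.inl b) = Sum.inl b
  /-- `P(R ∪ X) = (R ∖ X) ∪ Y` -/
  image_route : (fun b : BoxOf K => P (Sum.inl b)) ''
      {b : BoxOf K | b ∈ R ∨ ∃ i, b.val = X.box i} =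
    (Sum.inl '' {b : BoxOf K | b ∈ R ∧ ∀ i, b.val ≠ X.box i}) ∪
      Set.range (Sum.inr : Fin m → PB K m)

/-- The type of `m`-paths removing `X` (a path is the pair of the map and its route). -/
def MPath {K : Finset Cell} {m : ℕ} [NeZero m] (X : RemovalOn K m) : Type :=
  {PR : (PB K m → PB K m) × Finset (BoxOf K) // IsMPath X PR.1 PR.2}

instance {K : Finset Cell} {m : ℕ} [NeZero m] (X : RemovalOn K m) : Fintype (MPath X) := by
  unfold MPath; infer_instance

/-- The underlying map of boxes of a path. -/
def MPath.map {K : Finset Cell} {m : ℕ} [NeZero m] {X : RemovalOn K m} (P : MPath X) :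
    PB K m → PB K m := P.val.1

/-- The evacuation route of a path. -/
def MPath.route {K : Finset Cell} {m : ℕ} [NeZero m] {X : RemovalOn K m} (P : MPath X) :
    Finset (BoxOf K) := P.val.2

/-- `P⁻¹ z`: the (unique) box of the original shape whose image under `P` is `z`. -/
def pinv {K : Finset Cell} {m : ℕ} [NeZero m] (X : RemovalOn K m) (P : PB K m → PB K m)
    (z : PB K m) : BoxOf K :=
  @Function.invFun (BoxOf K) (PB K m) ⟨⟨X.box 0, X.mem 0⟩⟩ (fun b => P (Sum.inl b)) z

/-- `α_i^P`: the entry of `T` in the box `P⁻¹ (y_i)`. -/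
def alphaP {K : Finset Cell} {m n : ℕ} [NeZero m] (X : RemovalOn K m) (T : Tab K n)
    (P : PB K m → PB K m) (i : Fin m) : Fin n := T (pinv X P (Sum.inr i))

/-- `T_P`: the tableau of shape `λ ∖ X` with `(T_P)_z = T_{P⁻¹ z}`. -/
def TP {K : Finset Cell} {m n : ℕ} [NeZero m] (X : RemovalOn K m) (T : Tab K n)
    (P : PB K m → PB K m) : Tab X.kept n :=
  fun z => T (pinv X P (Sum.inl ⟨z.val, kept_subset X z.2⟩))

/-! ### Hook lengths and coefficients -/

/-- `H(b)` for the block `b` of width `w`, relative to the starting row `r₁`: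
`H(b) = (w_b - w_{b₁}) + (number of rows in blocks b₁, …, b-1)`. -/
def HW (K : Finset Cell) (r₁ w : ℕ) : ℤ :=
  ((w : ℤ) - (rowWidth K r₁ : ℤ)) +
    (((rowsOf K).filter fun ρ => rowWidth K r₁ ≤ rowWidth K ρ ∧ rowWidth K ρ < w).card : ℤ)

/-- `H(P)` for a `1`-path with route `R`: the product of `H(b)` over the blocks `b > b₁`
met by the route. -/
def HP1 (K : Finset Cell) (r₁ : ℕ) (R : Finset (BoxOf K)) : ℤ :=
  ∏ w ∈ (R.image fun b => rowWidth K b.val.1).filter (fun w => rowWidth K r₁ < w), HW K r₁ w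

/-- The rank (from the bottom, `1`-based) of a route box among the route boxes lying in the
same block. -/
def rankIn (K : Finset Cell) (R : Finset (BoxOf K)) (b : BoxOf K) : ℕ :=
  (R.filter fun b' => rowWidth K b'.val.1 = rowWidth K b.val.1 ∧ b.val.1 ≤ b'.val.1).card

/-- `H(P)` for an `m`-path with route `R`:
`H(P) = ∏_{b > b₁ met by R} ∏_{i=1}^{k_b} (H(b) - (m - i))`. -/
def HPm (K : Finset Cell) (m : ℕ) (r₁ : ℕ) (R : Finset (BoxOf K)) : ℤ :=
  ∏ b ∈ R.filter fun b => rowWidth K r₁ < rowWidth K b.val.1,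
    (HW K r₁ (rowWidth K b.val.1) - (m : ℤ) + (rankIn K R b : ℤ))

/-- The coefficient `(-1)^P / H(P)` of a `1`-path. -/
def coeff1 (K : Finset Cell) (r₁ : ℕ) (R : Finset (BoxOf K)) : ℂ :=
  (-1 : ℂ) ^ R.card / ((HP1 K r₁ R : ℤ) : ℂ)

/-- The coefficient `(-1)^P / H(P)` of an `m`-path. -/
def coeffm (K : Finset Cell) (m r₁ : ℕ) (R : Finset (BoxOf K)) : ℂ :=
  (-1 : ℂ) ^ R.card / ((HPm K m r₁ R : ℤ) : ℂ)

/-- The subspace `W ⊗ R_{K,n}` of `W ⊗ ℱ_{K,n}`. -/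
def tensR (W : Type) [AddCommGroup W] [Module ℂ W] (K : Finset Cell) (n : ℕ) :
    Submodule ℂ (W ⊗[ℂ] FreeT K n) :=
  Submodule.span ℂ {z | ∃ (a : W) (r : FreeT K n), r ∈ Rmod K n ∧ z = a ⊗ₜ[ℂ] r}

/-! ### Path extensions -/

/-- `B` is a `(ρ, ρ')`-route extension of `R`, where `ρ` is the (geometrically lower) row
with top-index `rlow` and `ρ'` the (higher) row with top-index `rhigh ≤ rlow`: the two
routes agree strictly below `ρ` and strictly above `ρ'`. -/
def RouteExt {K : Finset Cell} (rlow rhigh : ℕ) (R B : Finset (BoxOf K)) : Prop :=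
  R.filter (fun b => rlow < b.val.1) = B.filter (fun b => rlow < b.val.1) ∧
  R.filter (fun b => b.val.1 < rhigh) = B.filter (fun b => b.val.1 < rhigh)

/-- `Q` is a `(ρ, ρ')`-path extension of `P` (rows as in `RouteExt`). -/
def PathExt {K : Finset Cell} {m : ℕ} [NeZero m] {X : RemovalOn K m} (rlow rhigh : ℕ)
    (P Q : MPath X) : Prop :=
  RouteExt rlow rhigh P.route Q.route ∧
  (∀ b ∈ P.route, b.val.1 < rhigh → Q.map (Sum.inl b) = P.map (Sum.inl b)) ∧
  (∀ b ∈ P.route, rlow < b.val.1 →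
    ¬(∃ c : BoxOf K, P.map (Sum.inl b) = Sum.inl c ∧ rhigh ≤ c.val.1 ∧ c.val.1 ≤ rlow) →
    Q.map (Sum.inl b) = P.map (Sum.inl b))

/-! ### The Pieri inclusion removing one box -/

/-- `P(T) = e_{α₁^P} ⊗ T_P` for a `1`-path. -/
def pact1 {K : Finset Cell} {n : ℕ} (X : RemovalOn K 1) (T : Tab K n)
    (P : PB K 1 → PB K 1) : (Fin n → ℂ) ⊗[ℂ] FreeT X.kept n :=
  stdv n (alphaP X T P 0) ⊗ₜ[ℂ] Finsupp.single (TP X T P) 1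

/-- The Pieri inclusion `Φ₁ : ℱ_{λ,n} → V ⊗ ℱ_{λ∖X,n}`,
`Φ₁ T = ∑_P ((-1)^P / H(P)) P(T)`, the sum over all `1`-paths removing `X`. -/
def Phi1 {K : Finset Cell} (X : RemovalOn K 1) (n : ℕ) :
    FreeT K n →ₗ[ℂ] ((Fin n → ℂ) ⊗[ℂ] FreeT X.kept n) :=
  Finsupp.lift ((Fin n → ℂ) ⊗[ℂ] FreeT X.kept n) ℂ (Tab K n) fun T =>
    ∑ P : MPath X, coeff1 K (X.box 0).1 P.route • pact1 X T P.map

/-! ### Sums over chains of polarization operators -/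

/-- The rows weakly above `r₁` that are strictly shorter than row `c`. -/
def shorterRows (m : ℕ → ℕ) (r₁ c : ℕ) : Finset ℕ :=
  (Finset.range (r₁ + 1)).filter fun s => m s < m c

/-- The hook length attached to row `c`, in terms of the row lengths `m` of `λ ∖ X`. -/
def rowHook (m : ℕ → ℕ) (r₁ c : ℕ) : ℂ :=
  (m c : ℂ) - m r₁ - 1 + (shorterRows m r₁ c).card

/-- Operators `E a b` satisfying the commutation relations of `𝔤𝔩`, a linear map `π` which is
a highest weight vector of weight `m` for the right action, and the maps `F c` obtained from `π`
by summing over weighted chains of operators from row `r₁` up to row `c`. -/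
structure IsChainSystem {M Q : Type*} [AddCommGroup M] [Module ℂ M] [AddCommGroup Q] [Module ℂ Q]
    (E : Option ℕ → Option ℕ → M →ₗ[ℂ] M) (m : ℕ → ℕ) (r₁ : ℕ) (π : M →ₗ[ℂ] Q)
    (F : ℕ → M →ₗ[ℂ] Q) : Prop where
  comm : ∀ c d a b x, E c d (E a b x) =
    E a b (E c d x) + (if c = b then E a d x else 0) - (if d = a then E c b x else 0)
  anti : Antitone m
  corner : ∀ c < r₁, m r₁ < m c
  map_zero : ∀ a b, a ≠ b → m b ≤ m a → ∀ x, π (E (some a) (some b) x) = 0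
  map_diag : ∀ a x, π (E (some a) (some a) x) = (m a : ℂ) • π x
  base : ∀ x, F r₁ x = - π x
  step_same : ∀ c, c + 1 < r₁ → m (c + 1) = m c → ∀ x,
    F c x = - F (c + 1) (E (some (c + 1)) (some c) x)
  step_new : ∀ c < r₁, (c + 1 = r₁ ∨ m (c + 1) ≠ m c) → ∀ x,
    rowHook m r₁ c • F c x = - ∑ s ∈ Finset.Ioc c r₁, F s (E (some s) (some c) x)

namespace IsChainSystem

variable {M Q : Type*} [AddCommGroup M] [Module ℂ M] [AddCommGroup Q] [Module ℂ Q]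
  {E : Option ℕ → Option ℕ → M →ₗ[ℂ] M} {m : ℕ → ℕ} {r₁ : ℕ} {π : M →ₗ[ℂ] Q}
  {F : ℕ → M →ₗ[ℂ] Q}

lemma comm_some (h : IsChainSystem E m r₁ π F) (c d a b : ℕ) (x : M) :
    E (some c) (some d) (E (some a) (some b) x) =
      E (some a) (some b) (E (some c) (some d) x) +
        (if c = b then E (some a) (some d) x else 0) -
        (if d = a then E (some c) (some b) x else 0) := by
  simpa using h.comm (some c) (some d) (some a) (some b) x

lemma rowHook_ne_zero (h : IsChainSystem E m r₁ π F) {c : ℕ} (hc : c < r₁) :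
    rowHook m r₁ c ≠ 0 := by
  have h1 := h.corner c hc
  have h2 : 0 < (shorterRows m r₁ c).card :=
    Finset.card_pos.mpr ⟨r₁, by simp [shorterRows, h1]⟩
  have h3 : rowHook m r₁ c = ((m c - m r₁ - 1 + (shorterRows m r₁ c).card : ℕ) : ℂ) := by
    rw [rowHook, Nat.cast_add, Nat.cast_sub (by omega), Nat.cast_sub h1.le]
    simp
  rw [h3, Nat.cast_ne_zero]
  omega

lemma eq_zero_of_untouched (h : IsChainSystem E m r₁ π F) {a b : ℕ} (hab : a ≠ b)
    (hle : m b ≤ m a) {t : ℕ} (ht : t ≤ r₁) (htb : m t < m b) (x : M) :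
    F t (E (some a) (some b) x) = 0 := by
  induction hk : r₁ - t using Nat.strong_induction_on generalizing t x with
  | _ k ih =>
    have hta : t ≠ a := by rintro rfl; omega
    rcases ht.eq_or_lt with rfl | hlt
    · rw [h.base, h.map_zero a b hab hle, neg_zero]
    · have key : ∀ s, t < s → s ≤ r₁ →
          F s (E (some s) (some t) (E (some a) (some b) x)) = 0 := by
        intro s hs hs'
        have hms : m s ≤ m t := h.anti hs.le
        have hsb : s ≠ b := by rintro rfl; omega
        rw [h.comm_some, if_neg hsb, if_neg hta, add_zero, sub_zero]
        exact ih (r₁ - s) (by omega) hs' (by omega) _ rfl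
      by_cases hs : t + 1 < r₁ ∧ m (t + 1) = m t
      · rw [h.step_same t hs.1 hs.2, key _ (by omega) hs.1.le, neg_zero]
      · have := h.step_new t hlt (by by_contra hcon; push Not at hcon; exact hs ⟨by omega, hcon.2⟩)
          (E (some a) (some b) x)
        rw [Finset.sum_eq_zero, neg_zero, smul_eq_zero] at this
        · exact this.resolve_left (h.rowHook_ne_zero hlt)
        · intro s hs
          rw [Finset.mem_Ioc] at hs
          exact key s hs.1 hs.2

lemma step (h : IsChainSystem E m r₁ π F) {c : ℕ} (hc : c < r₁) (x : M) :
    rowHook m r₁ c • F c x =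
      - ∑ s ∈ shorterRows m r₁ c, F s (E (some s) (some c) x) := by
  induction hk : r₁ - c using Nat.strong_induction_on generalizing c x with
  | _ k ih =>
    by_cases hs : c + 1 < r₁ ∧ m (c + 1) = m c
    · have hlow : shorterRows m r₁ c = shorterRows m r₁ (c + 1) := by simp [shorterRows, hs.2]
      have hhook : rowHook m r₁ c = rowHook m r₁ (c + 1) := by rw [rowHook, rowHook, hs.2, hlow]
      rw [h.step_same c hs.1 hs.2, hhook, smul_neg, ih (r₁ - (c + 1)) (by omega) hs.1 _ rfl, hlow,
        neg_neg, ← Finset.sum_neg_distrib]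
      refine Finset.sum_congr rfl fun s hs' => ?_
      simp only [shorterRows, Finset.mem_filter, Finset.mem_range] at hs'
      have hsc : s ≠ c := by rintro rfl; omega
      rw [h.comm_some, if_neg hsc, if_pos rfl, add_zero, map_sub,
        h.eq_zero_of_untouched (by omega) hs.2.ge (by omega) (by omega), zero_sub]
    · have hs' : c + 1 = r₁ ∨ m (c + 1) ≠ m c := by
        by_contra hcon; push Not at hcon; exact hs ⟨by omega, hcon.2⟩
      rw [h.step_new c hc hs']
      congr 2
      ext s
      simp only [shorterRows, Finset.mem_Ioc, Finset.mem_filter, Finset.mem_range]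
      constructor
      · rintro ⟨h1, h2⟩
        refine ⟨by omega, ?_⟩
        rcases hs' with h3 | h3
        · obtain rfl : s = r₁ := by omega
          exact h.corner c hc
        · have h4 : m s ≤ m (c + 1) := h.anti (by omega)
          have h5 : m (c + 1) ≤ m c := h.anti (by omega)
          omega
      · rintro ⟨h1, h2⟩
        refine ⟨?_, by omega⟩
        by_contra hcon
        have := h.anti (show s ≤ c by omega)
        omega

lemma eq_of_rowHook_smul_eq (h : IsChainSystem E m r₁ π F) {c : ℕ} (hc : c < r₁) {u v : Q}
    (huv : rowHook m r₁ c • u = rowHook m r₁ c • v) : u = v :=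
  smul_right_injective Q (h.rowHook_ne_zero hc) huv

lemma diag_of_lt (h : IsChainSystem E m r₁ π F) {a t : ℕ} (ht : t ≤ r₁) (hta : m t < m a)
    (x : M) : F t (E (some a) (some a) x) = (m a : ℂ) • F t x := by
  induction hk : m t using Nat.strong_induction_on generalizing t x with
  | _ k ih =>
    rcases ht.eq_or_lt with rfl | hlt
    · rw [h.base, h.base, h.map_diag, smul_neg]
    · refine h.eq_of_rowHook_smul_eq hlt ?_
      rw [h.step hlt, smul_comm, h.step hlt, smul_neg, Finset.smul_sum]
      congr 1
      refine Finset.sum_congr rfl fun s hs => ?_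
      simp only [shorterRows, Finset.mem_filter, Finset.mem_range] at hs
      have h1 : s ≠ a := by rintro rfl; omega
      have h2 : t ≠ a := by rintro rfl; omega
      rw [h.comm_some, if_neg h1, if_neg h2, add_zero, sub_zero]
      exact ih (m s) (by omega) (by omega) (by omega) _ rfl

lemma diag_self (h : IsChainSystem E m r₁ π F) {b : ℕ} (hb : b < r₁) (x : M) :
    F b (E (some b) (some b) x) = ((m b : ℂ) - 1) • F b x := by
  refine h.eq_of_rowHook_smul_eq hb ?_
  rw [h.step hb, smul_comm, h.step hb, smul_neg, Finset.smul_sum]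
  congr 1
  refine Finset.sum_congr rfl fun s hs => ?_
  simp only [shorterRows, Finset.mem_filter, Finset.mem_range] at hs
  have h1 : s ≠ b := by rintro rfl; omega
  rw [h.comm_some, if_neg h1, if_pos rfl, add_zero, map_sub,
    h.diag_of_lt (by omega) (by omega), sub_smul, one_smul]

lemma eq_zero_of_below (h : IsChainSystem E m r₁ π F) {a b : ℕ} (hab : a < b) (hb : r₁ < b)
    {s : ℕ} (hs : s ≤ r₁) (x : M) : F s (E (some a) (some b) x) = 0 := by
  induction hk : m s using Nat.strong_induction_on generalizing s a x with
  | _ k ih =>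
    rcases hs.eq_or_lt with rfl | hlt
    · rw [h.base, h.map_zero a b hab.ne (h.anti hab.le), neg_zero]
    · refine h.eq_of_rowHook_smul_eq hlt ?_
      rw [h.step hlt, smul_zero, neg_eq_zero]
      refine Finset.sum_eq_zero fun t ht => ?_
      simp only [shorterRows, Finset.mem_filter, Finset.mem_range] at ht
      rw [h.comm_some, if_neg (by omega), add_zero, map_sub,
        ih (m t) (by omega) hab (by omega) _ rfl, zero_sub, neg_eq_zero]
      split_ifs
      · exact ih (m t) (by omega) (by omega) (by omega) _ rfl
      · exact _root_.map_zero _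

lemma comp_eq (h : IsChainSystem E m r₁ π F) {a b : ℕ} (hab : a ≠ b) (ha : a ≤ r₁) (hb : b ≤ r₁)
    (hle : m b ≤ m a) {s : ℕ} (hs : s ≤ r₁) (x : M) :
    F s (E (some a) (some b) x) = if s = a then - F b x else 0 := by
  induction hk : m s using Nat.strong_induction_on generalizing s a b x with
  | _ k ih =>
    have ha' : a < r₁ := by
      refine lt_of_le_of_ne ha ?_
      rintro rfl
      have := h.corner b (by omega)
      omega
    rcases hs.eq_or_lt with rfl | hlt
    · rw [h.base, h.map_zero a b hab hle, neg_zero, if_neg (by omega)]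
    refine h.eq_of_rowHook_smul_eq hlt ?_
    rw [h.step hlt]
    split_ifs with hsa
    · subst hsa
      have hsum : ∑ t ∈ shorterRows m r₁ s, F t (E (some t) (some s) (E (some s) (some b) x)) =
          (if b ∈ shorterRows m r₁ s then (m s : ℂ) • F b x else 0) -
            ∑ t ∈ shorterRows m r₁ s, F t (E (some t) (some b) x) := by
        rw [← Finset.sum_ite_eq' (shorterRows m r₁ s) b fun _ => (m s : ℂ) • F b x,
          ← Finset.sum_sub_distrib]
        refine Finset.sum_congr rfl fun t ht => ?_
        simp only [shorterRows, Finset.mem_filter, Finset.mem_range] at ht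
        have hts : t ≠ s := by rintro rfl; omega
        rw [h.comm_some, if_pos rfl, map_sub, map_add,
          ih (m t) (by omega) hab ha hb hle (by omega) _ rfl, if_neg hts, zero_add]
        congr 1
        split_ifs with htb
        · subst htb
          exact h.diag_of_lt hb (by omega) x
        · exact _root_.map_zero _
      rw [hsum]
      rcases hle.eq_or_lt with heq | hltm
      · have hlow : shorterRows m r₁ s = shorterRows m r₁ b := by simp [shorterRows, heq]
        have hbr : b < r₁ := by
          refine lt_of_le_of_ne hb ?_
          rintro rfl
          have := h.corner s hlt
          omega
        have hhook : rowHook m r₁ s = rowHook m r₁ b := by rw [rowHook, rowHook, heq, hlow]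
        have hnot : b ∉ shorterRows m r₁ s := by simp [shorterRows, heq]
        rw [if_neg hnot, hlow, hhook, smul_neg, h.step hbr]
        simp
      · have hmem : b ∈ shorterRows m r₁ s := by simp [shorterRows, hltm, hb]
        have hsub : shorterRows m r₁ b ⊆ (shorterRows m r₁ s).erase b := by
          intro t
          simp only [shorterRows, Finset.mem_filter, Finset.mem_range, Finset.mem_erase]
          rintro ⟨h1, h2⟩
          exact ⟨by rintro rfl; omega, h1, by omega⟩
        have hrest : ∑ t ∈ (shorterRows m r₁ s).erase b \ shorterRows m r₁ b,
            F t (E (some t) (some b) x) =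
            - ((((shorterRows m r₁ s).card : ℂ) - 1 - (shorterRows m r₁ b).card) • F b x) := by
          have hcard : (((shorterRows m r₁ s).erase b \ shorterRows m r₁ b).card : ℂ) =
              ((shorterRows m r₁ s).card : ℂ) - 1 - (shorterRows m r₁ b).card := by
            have h1 := Finset.card_sdiff_add_card_eq_card hsub
            have h2 := Finset.card_erase_add_one hmem
            rw [← h2, ← h1]
            push_cast
            ring
          rw [← hcard, Nat.cast_smul_eq_nsmul, ← Finset.sum_const, ← Finset.sum_neg_distrib]
          refine Finset.sum_congr rfl fun t ht => ?_
          simp only [shorterRows, Finset.mem_sdiff, Finset.mem_filter, Finset.mem_range,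
            Finset.mem_erase] at ht
          rw [ih (m t) (by omega) ht.1.1 (by omega) hb (by omega) (by omega) _ rfl, if_pos rfl]
        rw [if_pos hmem, ← Finset.add_sum_erase _ _ hmem, ← Finset.sum_sdiff hsub, hrest]
        rcases hb.eq_or_lt with rfl | hbr
        · have hempty : shorterRows m b b = ∅ := by
            rw [shorterRows, Finset.filter_eq_empty_iff]
            intro t ht
            have := h.anti (show t ≤ b by simpa [Nat.lt_succ_iff] using ht)
            omega
          have hd : F b (E (some b) (some b) x) = (m b : ℂ) • F b x := by
            rw [h.base, h.base, h.map_diag, smul_neg]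
          rw [hempty, hd, rowHook]
          simp only [Finset.sum_empty, Finset.card_empty]
          module
        · have hstep := h.step hbr x
          rw [eq_neg_iff_add_eq_zero, add_comm, ← eq_neg_iff_add_eq_zero] at hstep
          rw [hstep, h.diag_self hbr, rowHook, rowHook]
          module
    · rw [smul_zero, neg_eq_zero]
      have hsum : ∑ t ∈ shorterRows m r₁ s, F t (E (some t) (some s) (E (some a) (some b) x)) =
          (if b ∈ shorterRows m r₁ s then F b (E (some a) (some s) x) else 0) -
            (if a ∈ shorterRows m r₁ s then F b (E (some a) (some s) x) else 0) := by
        rw [← Finset.sum_ite_eq' (shorterRows m r₁ s) b fun _ => F b (E (some a) (some s) x),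
          ← Finset.sum_ite_eq' (shorterRows m r₁ s) a fun _ => F b (E (some a) (some s) x),
          ← Finset.sum_sub_distrib]
        refine Finset.sum_congr rfl fun t ht => ?_
        simp only [shorterRows, Finset.mem_filter, Finset.mem_range] at ht
        rw [h.comm_some, if_neg hsa, sub_zero, map_add,
          ih (m t) (by omega) hab ha hb hle (by omega) _ rfl]
        by_cases hta : t = a <;> by_cases htb : t = b <;> simp_all
      rw [hsum]
      by_cases hbs : m b < m s
      · by_cases has : m a < m s
        · simp [shorterRows, hbs, has, ha, hb]
        · rw [h.eq_zero_of_untouched (fun hh => hsa hh.symm) (by omega) hb hbs]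
          simp
      · have has : ¬ m a < m s := by omega
        simp [shorterRows, hbs, has]

/-- The sum over all chains from `r₁` to the extra row is annihilated by the operators that move
boxes downwards. -/
lemma sum_comp_eq_zero (h : IsChainSystem E m r₁ π F) {a b : ℕ} (hab : a < b) (x : M) :
    ∑ s ∈ Finset.range (r₁ + 1), F s (E (some s) none (E (some a) (some b) x)) = 0 := by
  have hcomm : ∀ s, E (some s) none (E (some a) (some b) x) =
      E (some a) (some b) (E (some s) none x) + if s = b then E (some a) none x else 0 := by
    intro s
    simpa using h.comm (some s) none (some a) (some b) x
  simp only [hcomm, map_add, Finset.sum_add_distrib]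
  by_cases hb : b ≤ r₁
  · have h1 : ∀ s ∈ Finset.range (r₁ + 1), F s (E (some a) (some b) (E (some s) none x)) =
        if s = a then - F b (E (some a) none x) else 0 := by
      intro s hs
      rw [h.comp_eq hab.ne (by omega) hb (h.anti hab.le) (by simpa [Nat.lt_succ_iff] using hs)]
      split_ifs with hsa
      · rw [hsa]
      · rfl
    have h2 : ∀ s ∈ Finset.range (r₁ + 1), F s (if s = b then E (some a) none x else 0) =
        if s = b then F b (E (some a) none x) else 0 := by
      intro s _
      split_ifs with hsb
      · rw [hsb]
      · exact _root_.map_zero _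
    rw [Finset.sum_congr rfl h1, Finset.sum_congr rfl h2, Finset.sum_ite_eq', Finset.sum_ite_eq',
      if_pos (by simp; omega), if_pos (by simp; omega), neg_add_cancel]
  · push Not at hb
    rw [Finset.sum_eq_zero, Finset.sum_eq_zero, add_zero]
    · intro s hs
      rw [if_neg (by simp at hs; omega), _root_.map_zero]
    · intro s hs
      exact h.eq_zero_of_below hab hb (by simpa [Nat.lt_succ_iff] using hs) _

end IsChainSystem

/-! ### Words as monomials, polarization operators -/

/-- The polynomial ring in variables `x_{r,i}` for a row `r` (`none` being the extra row) and a
letter `i`. -/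
abbrev RowPoly (n : ℕ) : Type := MvPolynomial (Option ℕ × Fin n) ℂ

/-- The monomial of a finite family of variables. -/
def word {n : ℕ} {B : Type*} [Fintype B] (f : B → Option ℕ × Fin n) : RowPoly n :=
  ∏ b, MvPolynomial.X (f b)

/-- The polarization operator `∑ i, x_{d,i} ∂/∂x_{c,i}`. -/
def polarization (n : ℕ) (c d : Option ℕ) : Derivation ℂ (RowPoly n) (RowPoly n) :=
  MvPolynomial.mkDerivation ℂ fun p => if p.1 = c then MvPolynomial.X (d, p.2) else 0

lemma polarization_X {n : ℕ} (c d : Option ℕ) (p : Option ℕ × Fin n) :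
    polarization n c d (MvPolynomial.X p) = if p.1 = c then MvPolynomial.X (d, p.2) else 0 := by
  rw [polarization, MvPolynomial.mkDerivation_X]

lemma polarization_comm {n : ℕ} (c d a b : Option ℕ) (x : RowPoly n) :
    polarization n c d (polarization n a b x) =
      polarization n a b (polarization n c d x) +
        (if c = b then polarization n a d x else 0) -
        (if d = a then polarization n c b x else 0) := by
  have h : ⁅polarization n c d, polarization n a b⁆ =
      (if c = b then polarization n a d else 0) - (if d = a then polarization n c b else 0) := by
    refine MvPolynomial.derivation_ext fun p => ?_
    rw [Derivation.commutator_apply, Derivation.sub_apply]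
    simp only [polarization_X, apply_ite (polarization n c d), apply_ite (polarization n a b),
      map_zero]
    by_cases h1 : p.1 = a <;> by_cases h2 : p.1 = c <;> by_cases h3 : c = b <;>
      by_cases h4 : d = a <;> simp_all [polarization_X, eq_comm]
  have h' := Derivation.congr_fun h x
  rw [Derivation.commutator_apply, Derivation.sub_apply, sub_eq_iff_eq_add] at h'
  rw [h']
  split_ifs <;> (try simp only [Derivation.zero_apply]) <;> abel

lemma derivation_prod {A ι : Type*} [DecidableEq ι] [CommRing A] [Algebra ℂ A]
    (D : Derivation ℂ A A)
    (s : Finset ι) (f : ι → A) :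
    D (∏ i ∈ s, f i) = ∑ i ∈ s, (∏ j ∈ s.erase i, f j) * D (f i) := by
  induction s using Finset.induction_on with
  | empty => simp
  | insert a s ha ih =>
    rw [Finset.prod_insert ha, D.leibniz, ih, Finset.sum_insert ha, Finset.erase_insert ha,
      smul_eq_mul, smul_eq_mul, Finset.mul_sum, add_comm]
    congr 1
    refine Finset.sum_congr rfl fun i hi => ?_
    have hia : i ≠ a := by rintro rfl; exact ha hi
    rw [Finset.erase_insert_of_ne hia.symm, Finset.prod_insert (by simp [ha]), mul_assoc]

lemma polarization_word {n : ℕ} {B : Type*} [Fintype B] [DecidableEq B] (c d : Option ℕ)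
    (f : B → Option ℕ × Fin n) :
    polarization n c d (word f) =
      ∑ b ∈ Finset.univ.filter fun b => (f b).1 = c, word (Function.update f b (d, (f b).2)) := by
  rw [word, derivation_prod, Finset.sum_filter]
  refine Finset.sum_congr rfl fun b _ => ?_
  rw [polarization_X]
  split_ifs
  · rw [word, ← Finset.mul_prod_erase _ _ (Finset.mem_univ b), Function.update_self, mul_comm]
    congr 1
    refine Finset.prod_congr rfl fun b' hb' => ?_
    rw [Function.update_of_ne (Finset.ne_of_mem_erase hb')]
  · rw [mul_zero]

lemma word_comp_equiv {n : ℕ} {B C : Type*} [Fintype B] [Fintype C] (e : B ≃ C)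
    (f : C → Option ℕ × Fin n) : word (f ∘ e) = word f :=
  Equiv.prod_comp e fun c => (MvPolynomial.X (f c) : RowPoly n)

lemma word_eq_monomial {n : ℕ} {B : Type*} [Fintype B] (f : B → Option ℕ × Fin n) :
    word f = MvPolynomial.monomial (∑ b, Finsupp.single (f b) 1) 1 := by
  rw [MvPolynomial.monomial_sum_one]
  rfl

lemma exists_equiv_of_word_eq {n : ℕ} {B C : Type*} [Fintype B] [Fintype C]
    {f : B → Option ℕ × Fin n} {g : C → Option ℕ × Fin n} (h : word f = word g) :
    ∃ e : B ≃ C, f = g ∘ e := by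
  rw [word_eq_monomial, word_eq_monomial] at h
  have h' := MvPolynomial.monomial_left_injective one_ne_zero h
  have hcard : ∀ p, Fintype.card {b // f b = p} = Fintype.card {c // g c = p} := by
    intro p
    have := DFunLike.congr_fun h' p
    simpa [Finsupp.finsetSum_apply, Finsupp.single_apply, Fintype.card_subtype] using this
  let e : ∀ p, {b // f b = p} ≃ {c // g c = p} := fun p => Fintype.equivOfCardEq (hcard p)
  refine ⟨(Equiv.sigmaFiberEquiv f).symm.trans
    ((Equiv.sigmaCongrRight e).trans (Equiv.sigmaFiberEquiv g)), ?_⟩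
  funext b
  exact ((e (f b)) ⟨b, rfl⟩).2.symm

lemma exists_word_eq_monomial {n : ℕ} (s : Option ℕ × Fin n →₀ ℕ) :
    ∃ (k : ℕ) (f : Fin k → Option ℕ × Fin n), MvPolynomial.monomial s 1 = word f := by
  refine ⟨s.toMultiset.toList.length, fun i => s.toMultiset.toList.get i, ?_⟩
  have h : word (fun i => s.toMultiset.toList.get i) =
      ((s.toMultiset.map (MvPolynomial.X (R := ℂ))).prod : RowPoly n) := by
    rw [word, ← List.prod_ofFn]
    conv_rhs => rw [← Multiset.coe_toList s.toMultiset, Multiset.map_coe, Multiset.prod_coe]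
    congr 1
    conv_rhs => rw [← List.ofFn_get s.toMultiset.toList, List.map_ofFn]
    rfl
  rw [h, Finsupp.toMultiset_map, Finsupp.prod_toMultiset, MvPolynomial.monomial_eq]
  simp only [map_one, one_mul]
  rw [Finsupp.prod_mapDomain_index] <;> simp [pow_add]

lemma rowPoly_induction {n : ℕ} {Q : Type*} [AddCommGroup Q] [Module ℂ Q]
    {φ ψ : RowPoly n →ₗ[ℂ] Q}
    (h : ∀ (k : ℕ) (f : Fin k → Option ℕ × Fin n), φ (word f) = ψ (word f)) : φ = ψ := by
  refine (MvPolynomial.basisMonomials _ ℂ).ext fun s => ?_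
  obtain ⟨k, f, hf⟩ := exists_word_eq_monomial s
  have hs : MvPolynomial.basisMonomials (Option ℕ × Fin n) ℂ s = word f := by
    rw [MvPolynomial.coe_basisMonomials]
    exact hf
  rw [hs, h]

/-- Moving a box from row `c` into row `d`, where the box `z₀` of row `d` has been put into row
`c`, amounts to exchanging entries. -/
lemma polarization_word_update {n : ℕ} {B : Type*} [Fintype B] [DecidableEq B] {c d : Option ℕ}
    (ρ : B → Option ℕ) (U : B → Fin n) {z₀ : B} (hz₀ : ρ z₀ = d) :
    polarization n c d (word (Function.update (fun z => (ρ z, U z)) z₀ (c, U z₀))) =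
      ∑ z ∈ insert z₀ (Finset.univ.filter fun z => ρ z = c),
        word fun z' => (ρ z', U (Equiv.swap z₀ z z')) := by
  rw [polarization_word]
  have hset : (Finset.univ.filter fun b =>
      (Function.update (fun z => (ρ z, U z)) z₀ (c, U z₀) b).1 = c) =
      insert z₀ (Finset.univ.filter fun z => ρ z = c) := by
    ext z
    by_cases hz : z = z₀
    · simp [hz]
    · simp [hz]
  rw [hset]
  refine Finset.sum_congr rfl fun z hz => ?_
  rw [Finset.mem_insert, Finset.mem_filter] at hz
  rw [← word_comp_equiv (Equiv.swap z₀ z) fun z' => (ρ z', U (Equiv.swap z₀ z z'))]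
  congr 1
  funext z'
  by_cases h0 : z = z₀
  · subst h0
    by_cases h1 : z' = z
    · simp [h1, hz₀]
    · simp [h1]
  · have hzc : ρ z = c := (hz.resolve_left h0).2
    by_cases h1 : z' = z
    · subst h1
      simp [h0, hz₀]
    · by_cases h2 : z' = z₀
      · subst h2
        simp [h1, hzc]
      · simp [h1, h2, Equiv.swap_apply_of_ne_of_ne h2 h1]

/-! ### Garnir elements of a row and one more box -/

lemma permAct_mul {K : Finset Cell} {n : ℕ} (σ τ : Equiv.Perm (BoxOf K)) (T : Tab K n) :
    permAct (σ * τ) T = permAct σ (permAct τ T) := by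
  funext x
  simp [permAct, mul_inv_rev]

lemma mem_SA {K : Finset Cell} {A : Finset (BoxOf K)} {σ : Equiv.Perm (BoxOf K)} :
    σ ∈ SA A ↔ ∀ x, x ∉ A → σ x = x := by
  simp [SA]

lemma SA_apply_mem {K : Finset Cell} {A : Finset (BoxOf K)} {σ : Equiv.Perm (BoxOf K)}
    (hσ : σ ∈ SA A) {x : BoxOf K} (hx : x ∈ A) : σ x ∈ A := by
  by_contra h
  have := mem_SA.mp hσ _ h
  rw [σ.injective this] at h
  exact h hx

lemma SA_inv_mem {K : Finset Cell} {A : Finset (BoxOf K)} {σ : Equiv.Perm (BoxOf K)}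
    (hσ : σ ∈ SA A) : σ⁻¹ ∈ SA A :=
  mem_SA.mpr fun x hx => by rw [Equiv.Perm.inv_eq_iff_eq, mem_SA.mp hσ x hx]

lemma SA_mul_mem {K : Finset Cell} {A : Finset (BoxOf K)} {σ τ : Equiv.Perm (BoxOf K)}
    (hσ : σ ∈ SA A) (hτ : τ ∈ SA A) : σ * τ ∈ SA A :=
  mem_SA.mpr fun x hx => by
    rw [Equiv.Perm.mul_apply, mem_SA.mp hτ x hx, mem_SA.mp hσ x hx]

lemma swap_mem_SA {K : Finset Cell} {A : Finset (BoxOf K)} {a b : BoxOf K}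
    (ha : a ∈ A) (hb : b ∈ A) : Equiv.swap a b ∈ SA A :=
  mem_SA.mpr fun x hx => Equiv.swap_apply_of_ne_of_ne (by rintro rfl; exact hx ha)
    (by rintro rfl; exact hx hb)

lemma mem_rowBoxes {K : Finset Cell} {r : ℕ} {b : BoxOf K} : b ∈ rowBoxes K r ↔ b.val.1 = r := by
  simp [rowBoxes]

lemma card_rowBoxes (K : Finset Cell) (r : ℕ) : (rowBoxes K r).card = rowWidth K r := by
  rw [rowWidth, rowBoxes]
  refine Finset.card_bij (fun b _ => b.val) ?_ ?_ ?_
  · intro b hb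
    simpa using hb
  · intro a _ b _ h
    exact Subtype.ext h
  · intro c hc
    rw [Finset.mem_filter] at hc
    exact ⟨⟨c, hc.1⟩, by simpa using hc.2, rfl⟩

/-- Up to permutations within rows, the Garnir sum over a row and one more box `b₀` is a multiple
of the sum over all exchanges of `b₀` with a box of the row. -/
lemma sum_SA_row_insert {K : Finset Cell} {n : ℕ} {Q : Type*} [AddCommGroup Q]
    {f : Tab K n → Q} (hf : ∀ T₁ T₂, RowEquiv T₁ T₂ → f T₁ = f T₂) {c : ℕ} {b₀ : BoxOf K}
    (T : Tab K n) :
    ∃ N : ℕ, N ≠ 0 ∧ ∑ σ ∈ SA (insert b₀ (rowBoxes K c)), f (permAct σ T) =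
      N • ∑ b ∈ insert b₀ (rowBoxes K c), f (permAct (Equiv.swap b₀ b) T) := by
  set A := insert b₀ (rowBoxes K c) with hA
  have hb₀ : b₀ ∈ A := Finset.mem_insert_self _ _
  refine ⟨((SA A).filter fun σ => σ⁻¹ b₀ = b₀).card, ?_, ?_⟩
  · refine Finset.card_ne_zero_of_mem (a := 1) ?_
    exact Finset.mem_filter.mpr ⟨mem_SA.mpr fun _ _ => rfl, rfl⟩
  rw [← Finset.sum_fiberwise_of_maps_to (g := fun σ => σ⁻¹ b₀)
    (fun σ hσ => SA_apply_mem (SA_inv_mem hσ) hb₀), Finset.smul_sum]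
  refine Finset.sum_congr rfl fun b hb => ?_
  have hcard : ((SA A).filter fun σ => σ⁻¹ b₀ = b₀).card =
      ((SA A).filter fun σ => σ⁻¹ b₀ = b).card := by
    have hs : Equiv.swap b₀ b ∈ SA A := swap_mem_SA hb₀ hb
    refine Finset.card_nbij' (· * Equiv.swap b₀ b) (· * Equiv.swap b₀ b) ?_ ?_ ?_ ?_
    · intro σ hσ
      rw [Finset.mem_coe, Finset.mem_filter] at hσ ⊢
      refine ⟨SA_mul_mem hσ.1 hs, ?_⟩
      rw [mul_inv_rev, Equiv.Perm.mul_apply, hσ.2, Equiv.swap_inv, Equiv.swap_apply_left]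
    · intro σ hσ
      rw [Finset.mem_coe, Finset.mem_filter] at hσ ⊢
      refine ⟨SA_mul_mem hσ.1 hs, ?_⟩
      rw [mul_inv_rev, Equiv.Perm.mul_apply, hσ.2, Equiv.swap_inv, Equiv.swap_apply_right]
    · intro σ _
      simp [mul_assoc]
    · intro σ _
      simp [mul_assoc]
  rw [hcard, ← Finset.sum_const]
  refine Finset.sum_congr rfl fun σ hσ => ?_
  rw [Finset.mem_filter] at hσ
  have hτ : σ * Equiv.swap b₀ b ∈ SA A := SA_mul_mem hσ.1 (swap_mem_SA hb₀ hb)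
  have hfix : (σ * Equiv.swap b₀ b) b₀ = b₀ := by
    rw [Equiv.Perm.mul_apply, Equiv.swap_apply_left, ← hσ.2]
    exact σ.apply_symm_apply b₀
  refine (hf _ _ ⟨σ * Equiv.swap b₀ b, fun x => ?_, ?_⟩).symm
  · by_cases hx : x = b₀
    · rw [hx, hfix]
    by_cases hxA : x ∈ A
    · have h1 := SA_apply_mem hτ hxA
      rw [hA, Finset.mem_insert, mem_rowBoxes] at h1 hxA
      rcases h1 with h1 | h1
      · exact absurd ((σ * Equiv.swap b₀ b).injective (h1.trans hfix.symm)) hx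
      · rw [h1, hxA.resolve_left hx]
    · rw [mem_SA.mp hτ x hxA]
  · rw [← permAct_mul, mul_assoc, Equiv.swap_mul_self, mul_one]

/-! ### Reading off classes of tableaux from polynomials -/

/-- The row of a box of `λ ∖ X`, or of the extra box. -/
def rowOpt {K : Finset Cell} (o : Option (BoxOf K)) : Option ℕ := o.map fun b => b.val.1

/-- The class of `e_{U none} ⊗ (U ∘ some)` in `V ⊗ ℱ / V ⊗ R`. -/
def tabClass {K : Finset Cell} {n : ℕ} (U : Option (BoxOf K) → Fin n) :
    ((Fin n → ℂ) ⊗[ℂ] FreeT K n) ⧸ tensR (Fin n → ℂ) K n :=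
  (tensR (Fin n → ℂ) K n).mkQ (stdv n (U none) ⊗ₜ[ℂ] Finsupp.single (fun z => U (some z)) 1)

/-- The monomial of a filling of `λ ∖ X` and the extra box. -/
def tabWord {K : Finset Cell} {n : ℕ} (U : Option (BoxOf K) → Fin n) : RowPoly n :=
  word fun o => (rowOpt o, U o)

lemma mkQ_tmul_eq_of_sub_mem {K : Finset Cell} {n : ℕ} {x y : FreeT K n}
    (h : x - y ∈ Rmod K n) (v : Fin n → ℂ) :
    (tensR (Fin n → ℂ) K n).mkQ (v ⊗ₜ[ℂ] x) = (tensR (Fin n → ℂ) K n).mkQ (v ⊗ₜ[ℂ] y) := by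
  rw [← sub_eq_zero, ← map_sub, ← TensorProduct.tmul_sub, Submodule.mkQ_apply,
    Submodule.Quotient.mk_eq_zero]
  exact Submodule.subset_span ⟨v, _, h, rfl⟩

lemma mkQ_tmul_single_of_rowEquiv {K : Finset Cell} {n : ℕ} {T₁ T₂ : Tab K n}
    (h : RowEquiv T₁ T₂) (v : Fin n → ℂ) :
    (tensR (Fin n → ℂ) K n).mkQ (v ⊗ₜ[ℂ] Finsupp.single T₁ 1) =
      (tensR (Fin n → ℂ) K n).mkQ (v ⊗ₜ[ℂ] Finsupp.single T₂ 1) :=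
  mkQ_tmul_eq_of_sub_mem (Submodule.subset_span (Or.inl ⟨T₁, T₂, h, rfl⟩)) v

lemma tabClass_eq_of_tabWord_eq {K : Finset Cell} {n : ℕ} {U U' : Option (BoxOf K) → Fin n}
    (h : tabWord U = tabWord U') : tabClass U = tabClass U' := by
  obtain ⟨e, he⟩ := exists_equiv_of_word_eq h
  have he' : ∀ o, rowOpt o = rowOpt (e o) ∧ U o = U' (e o) := fun o => by
    simpa using congrFun he o
  have hnone : e none = none := by
    have := (he' none).1
    simpa [rowOpt] using this.symm
  have hsome : ∀ z, some (Equiv.removeNone e z) = e (some z) := fun z => by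
    refine Equiv.removeNone_some e ?_
    rw [← Option.ne_none_iff_exists']
    intro hz
    exact Option.some_ne_none z (e.injective (hz.trans hnone.symm))
  have hU : U none = U' none := by rw [(he' none).2, hnone]
  rw [tabClass, tabClass, hU]
  refine mkQ_tmul_single_of_rowEquiv ⟨Equiv.removeNone e, fun x => ?_, ?_⟩ _
  · have := (he' (some x)).1
    rw [← hsome] at this
    simpa [rowOpt] using this.symm
  · funext x
    rw [permAct, (he' _).2, ← hsome]
    exact congrArg (fun z => U' (some z)) ((Equiv.removeNone e).apply_symm_apply x).symm

/-- The linear map sending the monomial of a filling to its class, and all other monomials to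
zero. -/
def classMap (K : Finset Cell) (n : ℕ) :
    RowPoly n →ₗ[ℂ] ((Fin n → ℂ) ⊗[ℂ] FreeT K n) ⧸ tensR (Fin n → ℂ) K n :=
  (MvPolynomial.basisMonomials (Option ℕ × Fin n) ℂ).constr ℂ fun s =>
    if h : ∃ U : Option (BoxOf K) → Fin n, MvPolynomial.monomial s 1 = tabWord U then
      tabClass h.choose else 0

lemma classMap_monomial {K : Finset Cell} {n : ℕ} (s : Option ℕ × Fin n →₀ ℕ) :
    classMap K n (MvPolynomial.monomial s 1) =
      if h : ∃ U : Option (BoxOf K) → Fin n, MvPolynomial.monomial s 1 = tabWord U then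
        tabClass h.choose else 0 := by
  have := (MvPolynomial.basisMonomials (Option ℕ × Fin n) ℂ).constr_basis ℂ (fun s =>
    if h : ∃ U : Option (BoxOf K) → Fin n, MvPolynomial.monomial s 1 = tabWord U then
      tabClass h.choose else 0) s
  rw [MvPolynomial.coe_basisMonomials] at this
  exact this

lemma classMap_tabWord {K : Finset Cell} {n : ℕ} (U : Option (BoxOf K) → Fin n) :
    classMap K n (tabWord U) = tabClass U := by
  have h : ∃ U' : Option (BoxOf K) → Fin n, tabWord U = tabWord U' := ⟨U, rfl⟩
  rw [tabWord, word_eq_monomial, classMap_monomial]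
  rw [tabWord, word_eq_monomial] at h
  rw [dif_pos h]
  refine (tabClass_eq_of_tabWord_eq ?_).symm
  rw [← h.choose_spec, tabWord, word_eq_monomial]

lemma classMap_word_eq_zero {K : Finset Cell} {n : ℕ} {B : Type*} [Fintype B]
    {f : B → Option ℕ × Fin n}
    (h : ¬ ∃ U : Option (BoxOf K) → Fin n, word f = tabWord U) : classMap K n (word f) = 0 := by
  rw [word_eq_monomial] at h ⊢
  rw [classMap_monomial, dif_neg h]

lemma filter_rowOpt_eq {K : Finset Cell} (c : ℕ) :
    (Finset.univ.filter fun o : Option (BoxOf K) => rowOpt o = some c) =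
      (rowBoxes K c).map Function.Embedding.some := by
  ext o
  cases o with
  | none => simp [rowOpt]
  | some z =>
    rw [Finset.mem_filter, Finset.mem_map]
    simp only [Finset.mem_univ, true_and, mem_rowBoxes, rowOpt, Option.map_some,
      Option.some.injEq, Function.Embedding.some_apply, exists_eq_right]

lemma classMap_diag {K : Finset Cell} {n : ℕ} (a : ℕ) (x : RowPoly n) :
    classMap K n (polarization n (some a) (some a) x) =
      (rowWidth K a : ℂ) • classMap K n x := by
  suffices h : (classMap K n).comp (polarization n (some a) (some a)).toLinearMap =
      (rowWidth K a : ℂ) • classMap K n from LinearMap.congr_fun h x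
  refine rowPoly_induction fun k f => ?_
  have hself : ∀ b, (f b).1 = some a → Function.update f b (some a, (f b).2) = f := by
    intro b hb
    rw [← hb]
    exact Function.update_eq_self b f
  change classMap K n (polarization n (some a) (some a) (word f)) =
    (rowWidth K a : ℂ) • classMap K n (word f)
  rw [polarization_word, Finset.sum_congr rfl fun b hb => by
    rw [hself b (Finset.mem_filter.mp hb).2], Finset.sum_const, map_nsmul]
  by_cases h : ∃ U : Option (BoxOf K) → Fin n, word f = tabWord U
  · obtain ⟨U, hU⟩ := h
    obtain ⟨e, he⟩ := exists_equiv_of_word_eq hU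
    have hcard : (Finset.univ.filter fun b => (f b).1 = some a).card = rowWidth K a := by
      rw [← card_rowBoxes, ← Finset.card_map (s := rowBoxes K a) Function.Embedding.some,
        ← filter_rowOpt_eq]
      refine Finset.card_bij (fun b _ => e b) ?_ (fun _ _ _ _ h => e.injective h) ?_
      · intro b hb
        rw [Finset.mem_filter, he] at hb
        exact Finset.mem_filter.mpr ⟨Finset.mem_univ _, hb.2⟩
      · intro o ho
        refine ⟨e.symm o, ?_, e.apply_symm_apply o⟩
        rw [Finset.mem_filter] at ho ⊢
        rw [he]
        simpa using ho.2
    rw [hcard, Nat.cast_smul_eq_nsmul]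
  · rw [classMap_word_eq_zero h, smul_zero, smul_zero]

lemma sum_tabClass_swap {K : Finset Cell} {n : ℕ} {c : ℕ} {b₀ : BoxOf K} (hb₀ : b₀.val.1 ≠ c)
    (hw : rowWidth K b₀.val.1 ≤ rowWidth K c) (U : Option (BoxOf K) → Fin n) :
    ∑ b ∈ insert b₀ (rowBoxes K c),
      tabClass (fun o => U (Equiv.swap (some b₀) (some b) o)) = 0 := by
  let f : Tab K n → ((Fin n → ℂ) ⊗[ℂ] FreeT K n) ⧸ tensR (Fin n → ℂ) K n := fun T =>
    (tensR (Fin n → ℂ) K n).mkQ (stdv n (U none) ⊗ₜ[ℂ] Finsupp.single T 1)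
  obtain ⟨N, hN, hsum⟩ := sum_SA_row_insert (f := f) (c := c) (b₀ := b₀)
    (fun T₁ T₂ h => mkQ_tmul_single_of_rowEquiv h _) (fun z => U (some z))
  have hgarnir : garnir (insert b₀ (rowBoxes K c)) (fun z => U (some z)) ∈ Rmod K n := by
    refine Submodule.subset_span (Or.inr ⟨_, _, ?_, rfl⟩)
    rw [Finset.card_insert_of_notMem (by rwa [mem_rowBoxes]), card_rowBoxes, Nat.lt_succ_iff, wA]
    refine Finset.sup_le fun x hx => ?_
    rw [Finset.mem_insert, mem_rowBoxes] at hx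
    rcases hx with rfl | hx
    · exact hw
    · rw [hx]
  have hzero : ∑ σ ∈ SA (insert b₀ (rowBoxes K c)), f (permAct σ fun z => U (some z)) = 0 := by
    have := mkQ_tmul_eq_of_sub_mem (y := 0) (by rwa [sub_zero]) (stdv n (U none))
    rw [TensorProduct.tmul_zero, map_zero, garnir, TensorProduct.tmul_sum, map_sum] at this
    exact this
  rw [hzero, ← Nat.cast_smul_eq_nsmul ℂ, eq_comm, smul_eq_zero, Nat.cast_eq_zero] at hsum
  rw [← hsum.resolve_left hN]
  refine Finset.sum_congr rfl fun b _ => ?_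
  have h1 : Equiv.swap (some b₀) (some b) none = none :=
    Equiv.swap_apply_of_ne_of_ne (by simp) (by simp)
  have h2 : (fun z => U (Equiv.swap (some b₀) (some b) (some z))) =
      permAct (Equiv.swap b₀ b) fun z => U (some z) := by
    funext z
    rw [permAct, Equiv.swap_inv, (Option.some_injective _).swap_apply]
  simp only [tabClass, f, h1, h2]

lemma classMap_zero {K : Finset Cell} {n : ℕ} {c d : ℕ} (hcd : c ≠ d)
    (hw : rowWidth K d ≤ rowWidth K c) (x : RowPoly n) :
    classMap K n (polarization n (some c) (some d) x) = 0 := by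
  suffices h : (classMap K n).comp (polarization n (some c) (some d)).toLinearMap = 0 from
    LinearMap.congr_fun h x
  refine rowPoly_induction fun k f => ?_
  change classMap K n (polarization n (some c) (some d) (word f)) = 0
  by_cases h : ∃ b₀, (f b₀).1 = some c ∧ ∃ U : Option (BoxOf K) → Fin n,
      word (Function.update f b₀ (some d, (f b₀).2)) = tabWord U
  · obtain ⟨b₀, hb₀, U, hU⟩ := h
    obtain ⟨e, he⟩ := exists_equiv_of_word_eq hU
    have hz₀ : (some d, (f b₀).2) = (rowOpt (e b₀), U (e b₀)) := by
      simpa using congrFun he b₀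
    rw [Prod.mk.injEq] at hz₀
    obtain ⟨z₀, hz⟩ : ∃ z₀, e b₀ = some z₀ := by
      rw [← Option.ne_none_iff_exists']
      intro hnone
      rw [hnone] at hz₀
      simp [rowOpt] at hz₀
    have hrow : z₀.val.1 = d := by
      have := hz₀.1
      rw [hz] at this
      simpa [rowOpt] using this.symm
    have hf : f =
        Function.update (fun o => (rowOpt o, U o)) (some z₀) (some c, U (some z₀)) ∘ e := by
      funext b
      by_cases hb : b = b₀
      · subst hb
        rw [Function.comp_apply, hz, Function.update_self, ← hz, ← hz₀.2, ← hb₀]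
      · have hne : e b ≠ some z₀ := by
          rw [← hz]
          exact fun hh => hb (e.injective hh)
        have := congrFun he b
        rw [Function.update_of_ne hb] at this
        rw [Function.comp_apply, Function.update_of_ne hne, this]
        rfl
    rw [hf, word_comp_equiv, polarization_word_update (ρ := rowOpt) (c := some c) (d := some d)
      (z₀ := some z₀) U (by rw [← hz]; exact hz₀.1.symm),
      filter_rowOpt_eq, map_sum]
    have hins : insert (some z₀) ((rowBoxes K c).map Function.Embedding.some) =
        (insert z₀ (rowBoxes K c)).map Function.Embedding.some := by
      rw [Finset.map_insert]
      rfl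
    rw [hins, Finset.sum_map, ← sum_tabClass_swap (c := c) (b₀ := z₀) (by omega)
      (by rwa [hrow]) U]
    exact Finset.sum_congr rfl fun b _ => classMap_tabWord _
  · rw [polarization_word, map_sum]
    refine Finset.sum_eq_zero fun b hb => classMap_word_eq_zero fun hU => h ⟨b, ?_, hU⟩
    exact (Finset.mem_filter.mp hb).2

/-! ### Row lengths of the shape and of the shape with a box removed -/

lemma rowWidth_cells (μ : YoungDiagram) (r : ℕ) : rowWidth μ.cells r = μ.rowLen r := by
  rw [YoungDiagram.rowLen_eq_card]
  rfl

lemma rowWidth_anti (μ : YoungDiagram) : Antitone (rowWidth μ.cells) := fun a b h => by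
  rw [rowWidth_cells, rowWidth_cells]
  exact μ.rowLen_anti a b h

lemma mem_kept {K : Finset Cell} {X : RemovalOn K 1} {c : Cell} :
    c ∈ X.kept ↔ c ∈ K ∧ c ≠ X.box 0 := by
  simp [keptUpTo]

lemma kept_eq_erase {K : Finset Cell} (X : RemovalOn K 1) : X.kept = K.erase (X.box 0) := by
  ext c
  rw [mem_kept, Finset.mem_erase, and_comm]

lemma rowWidth_kept_of_ne {K : Finset Cell} (X : RemovalOn K 1) {r : ℕ} (hr : r ≠ (X.box 0).1) :
    rowWidth X.kept r = rowWidth K r := by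
  rw [rowWidth, rowWidth, kept_eq_erase, Finset.filter_erase, Finset.erase_eq_of_notMem]
  rw [Finset.mem_filter]
  exact fun h => hr h.2.symm

lemma rowWidth_kept_self {K : Finset Cell} (X : RemovalOn K 1) :
    rowWidth X.kept (X.box 0).1 + 1 = rowWidth K (X.box 0).1 := by
  rw [rowWidth, rowWidth, kept_eq_erase, Finset.filter_erase, Finset.card_erase_add_one]
  exact Finset.mem_filter.mpr ⟨X.mem 0, rfl⟩

lemma rowWidth_lt_of_lt {μ : YoungDiagram} (X : RemovalOn μ.cells 1) {r : ℕ}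
    (hr : (X.box 0).1 < r) : rowWidth μ.cells r < rowWidth μ.cells (X.box 0).1 := by
  by_contra! h
  have hmem : ((r, (X.box 0).2) : Cell) ∈ X.kept := by
    refine mem_kept.mpr ⟨?_, fun he => hr.ne (congrArg Prod.fst he).symm⟩
    rw [YoungDiagram.mem_cells, YoungDiagram.mem_iff_lt_rowLen, ← rowWidth_cells]
    have := X.lastCol 0
    omega
  have hlow : X.box 0 ∈ X.kept := X.lower
    (show X.box 0 ≤ (r, (X.box 0).2) from ⟨hr.le, le_rfl⟩) hmem
  exact (mem_kept.mp hlow).2 rfl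

lemma le_of_rowWidth_le {μ : YoungDiagram} (X : RemovalOn μ.cells 1) {r : ℕ}
    (hr : rowWidth μ.cells (X.box 0).1 ≤ rowWidth μ.cells r) : r ≤ (X.box 0).1 := by
  by_contra! h
  exact (rowWidth_lt_of_lt X h).not_ge hr

lemma rowWidth_kept_anti {μ : YoungDiagram} (X : RemovalOn μ.cells 1) :
    Antitone (rowWidth X.kept) := by
  intro a b hab
  have h1 := rowWidth_kept_self X
  have h2 := rowWidth_anti μ hab
  by_cases ha : a = (X.box 0).1 <;> by_cases hb : b = (X.box 0).1
  · rw [ha, hb]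
  · have := rowWidth_lt_of_lt X (r := b) (by omega)
    rw [rowWidth_kept_of_ne X hb, ha]
    omega
  · rw [rowWidth_kept_of_ne X ha, hb]
    rw [hb] at h2
    omega
  · rwa [rowWidth_kept_of_ne X ha, rowWidth_kept_of_ne X hb]

lemma HW_pos {K : Finset Cell} {r₁ w : ℕ} (h : rowWidth K r₁ < w) : 0 < HW K r₁ w := by
  rw [HW]
  omega

lemma rowHook_eq_HW {μ : YoungDiagram} (X : RemovalOn μ.cells 1) {c : ℕ} (hc : c < (X.box 0).1)
    (h : rowWidth μ.cells (X.box 0).1 < rowWidth μ.cells c) :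
    rowHook (rowWidth X.kept) (X.box 0).1 c =
      (HW μ.cells (X.box 0).1 (rowWidth μ.cells c) : ℂ) := by
  have h1 := rowWidth_kept_self X
  have hset : shorterRows (rowWidth X.kept) (X.box 0).1 c =
      (rowsOf μ.cells).filter fun ρ => rowWidth μ.cells (X.box 0).1 ≤ rowWidth μ.cells ρ ∧
        rowWidth μ.cells ρ < rowWidth μ.cells c := by
    ext s
    rw [shorterRows, Finset.mem_filter, Finset.mem_filter, Finset.mem_range,
      rowWidth_kept_of_ne X hc.ne, Nat.lt_succ_iff]
    constructor
    · rintro ⟨hs, hlt⟩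
      have hge := rowWidth_anti μ hs
      refine ⟨?_, hge, ?_⟩
      · have hpos : 0 < rowWidth μ.cells s := by omega
        rw [rowWidth, Finset.card_pos] at hpos
        obtain ⟨z, hz⟩ := hpos
        rw [Finset.mem_filter] at hz
        exact Finset.mem_image.mpr ⟨z, hz⟩
      · by_cases hs' : s = (X.box 0).1
        · rwa [hs']
        · rwa [rowWidth_kept_of_ne X hs'] at hlt
    · rintro ⟨-, hge, hlt⟩
      refine ⟨le_of_rowWidth_le X hge, ?_⟩
      by_cases hs' : s = (X.box 0).1
      · rw [hs']
        omega
      · rwa [rowWidth_kept_of_ne X hs']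
  rw [rowHook, HW, hset, rowWidth_kept_of_ne X hc.ne, ← h1]
  push_cast
  ring

lemma rowHook_eq_one {μ : YoungDiagram} (X : RemovalOn μ.cells 1) {c : ℕ} (hc : c < (X.box 0).1)
    (h : rowWidth μ.cells (X.box 0).1 = rowWidth μ.cells c) :
    rowHook (rowWidth X.kept) (X.box 0).1 c = 1 := by
  have h1 := rowWidth_kept_self X
  have hset : shorterRows (rowWidth X.kept) (X.box 0).1 c = {(X.box 0).1} := by
    ext s
    rw [shorterRows, Finset.mem_filter, Finset.mem_range, Finset.mem_singleton,
      rowWidth_kept_of_ne X hc.ne, Nat.lt_succ_iff]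
    constructor
    · rintro ⟨hs, hlt⟩
      by_contra hs'
      have := rowWidth_anti μ hs
      rw [rowWidth_kept_of_ne X hs'] at hlt
      omega
    · rintro rfl
      exact ⟨le_rfl, by omega⟩
  rw [rowHook, hset, rowWidth_kept_of_ne X hc.ne, ← h, ← h1]
  simp

/-! ### Weighted chains of polarization operators -/

/-- The signed weighted sum over chains from row `r₁` up to row `c` of products of polarization
operators, followed by `classMap`. -/
def chainMap {μ : YoungDiagram} (X : RemovalOn μ.cells 1) (n : ℕ) (c : ℕ) :
    RowPoly n →ₗ[ℂ] ((Fin n → ℂ) ⊗[ℂ] FreeT X.kept n) ⧸ tensR (Fin n → ℂ) X.kept n :=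
  if c < (X.box 0).1 then
    if rowWidth μ.cells (c + 1) = rowWidth μ.cells c then
      -(chainMap X n (c + 1)).comp (polarization n (some (c + 1)) (some c)).toLinearMap
    else
      (-(HW μ.cells (X.box 0).1 (rowWidth μ.cells c) : ℂ)⁻¹) •
        ∑ s ∈ (Finset.Ioc c (X.box 0).1).attach,
          (chainMap X n s.1).comp (polarization n (some s.1) (some c)).toLinearMap
  else -classMap X.kept n
termination_by (X.box 0).1 - c
decreasing_by
  · omega
  · have := Finset.mem_Ioc.mp s.2
    omega

lemma chainMap_self {μ : YoungDiagram} (X : RemovalOn μ.cells 1) (n : ℕ) :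
    chainMap X n (X.box 0).1 = -classMap X.kept n := by
  rw [chainMap, if_neg (lt_irrefl _)]

lemma chainMap_same {μ : YoungDiagram} (X : RemovalOn μ.cells 1) (n : ℕ) {c : ℕ}
    (hc : c < (X.box 0).1) (h : rowWidth μ.cells (c + 1) = rowWidth μ.cells c) (x : RowPoly n) :
    chainMap X n c x = -chainMap X n (c + 1) (polarization n (some (c + 1)) (some c) x) := by
  rw [chainMap, if_pos hc, if_pos h]
  rfl

lemma chainMap_new {μ : YoungDiagram} (X : RemovalOn μ.cells 1) (n : ℕ) {c : ℕ}
    (hc : c < (X.box 0).1) (h : rowWidth μ.cells (c + 1) ≠ rowWidth μ.cells c) (x : RowPoly n) :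
    chainMap X n c x = (-(HW μ.cells (X.box 0).1 (rowWidth μ.cells c) : ℂ)⁻¹) •
      ∑ s ∈ Finset.Ioc c (X.box 0).1, chainMap X n s (polarization n (some s) (some c) x) := by
  rw [chainMap, if_pos hc, if_neg h, LinearMap.smul_apply, LinearMap.sum_apply,
    ← Finset.sum_attach (Finset.Ioc c (X.box 0).1)]
  rfl

lemma isChainSystem_chainMap {μ : YoungDiagram} (X : RemovalOn μ.cells 1) (n : ℕ) :
    IsChainSystem (fun c d => (polarization n c d).toLinearMap) (rowWidth X.kept) (X.box 0).1
      (classMap X.kept n) (chainMap X n) where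
  comm c d a b x := polarization_comm c d a b x
  anti := rowWidth_kept_anti X
  corner c hc := by
    have h1 := rowWidth_kept_self X
    have h2 := rowWidth_anti μ hc.le
    rw [rowWidth_kept_of_ne X hc.ne]
    omega
  map_zero a b hab hw x := classMap_zero hab hw x
  map_diag a x := classMap_diag a x
  base x := by
    rw [chainMap_self]
    rfl
  step_same c hc hw x := by
    rw [rowWidth_kept_of_ne X (by omega), rowWidth_kept_of_ne X (by omega)] at hw
    exact chainMap_same X n (by omega) hw x
  step_new c hc hcase x := by
    by_cases h : rowWidth μ.cells (c + 1) = rowWidth μ.cells c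
    · have hc1 : c + 1 = (X.box 0).1 := by
        by_contra hne
        rw [rowWidth_kept_of_ne X hne, rowWidth_kept_of_ne X hc.ne] at hcase
        exact hcase.elim hne fun h' => h' h
      rw [rowHook_eq_one X hc (by rw [← hc1, h]), one_smul, chainMap_same X n hc h, ← hc1,
        Nat.Ioc_succ_singleton, Finset.sum_singleton]
      rfl
    · have hlt : rowWidth μ.cells (X.box 0).1 < rowWidth μ.cells c :=
        (rowWidth_anti μ (Nat.succ_le_of_lt hc)).trans_lt
          (lt_of_le_of_ne (rowWidth_anti μ (Nat.le_succ c)) h)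
      rw [rowHook_eq_HW X hc hlt, chainMap_new X n hc h, smul_smul, mul_neg,
        mul_inv_cancel₀ (Int.cast_ne_zero.mpr (HW_pos hlt).ne'), neg_one_smul]
      rfl

/-! ### Evacuation routes -/

/-- The evacuation routes all of whose boxes lie in row `r₁` or above it. -/
def routes (K : Finset Cell) (r₁ : ℕ) : Finset (Finset (BoxOf K)) :=
  Finset.univ.filter fun R => IsEvacRoute K r₁ R ∧ ∀ b ∈ R, b.val.1 ≤ r₁

/-- The (geometrically) topmost row met by a set of boxes. -/
def topRow {K : Finset Cell} (R : Finset (BoxOf K)) : ℕ := sInf {r | ∃ b ∈ R, b.val.1 = r}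

/-- The routes with topmost row `s`. -/
def routesTop (K : Finset Cell) (r₁ s : ℕ) : Finset (Finset (BoxOf K)) :=
  (routes K r₁).filter fun R => topRow R = s

/-- Every box of `R` is moved to the next higher row of `R`, or to `d` if there is none. -/
def pushRow {K : Finset Cell} (R : Finset (BoxOf K)) (ρ : BoxOf K → Option ℕ) (d : Option ℕ)
    (b : BoxOf K) : Option ℕ :=
  if b ∈ R then
    if h : ((R.image fun z => z.val.1).filter (· < b.val.1)).Nonempty then
      some (((R.image fun z => z.val.1).filter (· < b.val.1)).max' h)
    else d
  else ρ b

lemma topRow_le {K : Finset Cell} {R : Finset (BoxOf K)} {b : BoxOf K} (hb : b ∈ R) :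
    topRow R ≤ b.val.1 := Nat.sInf_le ⟨b, hb, rfl⟩

lemma exists_mem_topRow {K : Finset Cell} {R : Finset (BoxOf K)} (hR : R.Nonempty) :
    ∃ b ∈ R, b.val.1 = topRow R := by
  obtain ⟨b, hb⟩ := hR
  exact Nat.sInf_mem (s := {r | ∃ b ∈ R, b.val.1 = r}) ⟨_, b, hb, rfl⟩

lemma topRow_eq {K : Finset Cell} {R : Finset (BoxOf K)} {b : BoxOf K} (hb : b ∈ R)
    (h : ∀ z ∈ R, b.val.1 ≤ z.val.1) : topRow R = b.val.1 := by
  obtain ⟨z, hz, hz'⟩ := exists_mem_topRow ⟨b, hb⟩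
  exact le_antisymm (topRow_le hb) (hz' ▸ h z hz)

lemma mem_routes {K : Finset Cell} {r₁ : ℕ} {R : Finset (BoxOf K)} :
    R ∈ routes K r₁ ↔ IsEvacRoute K r₁ R ∧ ∀ b ∈ R, b.val.1 ≤ r₁ := by
  simp [routes]

lemma mem_routesTop {K : Finset Cell} {r₁ s : ℕ} {R : Finset (BoxOf K)} :
    R ∈ routesTop K r₁ s ↔ R ∈ routes K r₁ ∧ topRow R = s := by
  simp [routesTop]

lemma nonempty_of_mem_routes {K : Finset Cell} {r₁ : ℕ} {R : Finset (BoxOf K)}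
    (hR : R ∈ routes K r₁) : R.Nonempty := by
  obtain ⟨b, hb, -⟩ := (mem_routes.mp hR).1.start
  exact ⟨b, hb⟩

lemma lt_row_of_mem_routesTop {K : Finset Cell} {r₁ s t : ℕ} {R : Finset (BoxOf K)}
    (hR : R ∈ routesTop K r₁ t) (hst : s < t) {z : BoxOf K} (hz : z ∈ R) : s < z.val.1 :=
  hst.trans_le ((mem_routesTop.mp hR).2 ▸ topRow_le hz)

lemma routesTop_self (K : Finset Cell) (r₁ : ℕ)
    (hw : ∀ r, r₁ < r → rowWidth K r ≠ rowWidth K r₁) :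
    routesTop K r₁ r₁ = (rowBoxes K r₁).image fun b => {b} := by
  ext R
  rw [mem_routesTop, mem_routes, Finset.mem_image]
  constructor
  · rintro ⟨⟨hR, hle⟩, htop⟩
    obtain ⟨b, hb, hbr⟩ := hR.start
    refine ⟨b, mem_rowBoxes.mpr hbr, Eq.symm (Finset.eq_singleton_iff_unique_mem.mpr ⟨hb, ?_⟩)⟩
    intro z hz
    have h1 := hle z hz
    have h2 := topRow_le hz
    exact hR.one_per_row _ hz _ hb (by omega)
  · rintro ⟨b, hb, rfl⟩
    rw [mem_rowBoxes] at hb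
    refine ⟨⟨⟨⟨b, Finset.mem_singleton_self b, hb⟩, ?_, ?_⟩, ?_⟩, ?_⟩
    · intro z hz z' hz' _
      rw [Finset.mem_singleton] at hz hz'
      rw [hz, hz']
    · intro z hz r hr hwr
      rw [Finset.mem_singleton] at hz
      subst hz
      rw [hb] at hr hwr
      exact absurd hwr (hw r hr)
    · intro z hz
      rw [Finset.mem_singleton] at hz
      rw [hz, hb]
    · rw [topRow_eq (Finset.mem_singleton_self b) fun z hz => by rw [Finset.mem_singleton.mp hz],
        hb]

/-- The possible topmost rows of a route after its box in row `s` has been removed. -/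
def nextRows (K : Finset Cell) (r₁ s : ℕ) : Finset ℕ :=
  if rowWidth K (s + 1) = rowWidth K s then {s + 1} else Finset.Ioc s r₁

lemma lt_of_mem_nextRows {K : Finset Cell} {r₁ s t : ℕ} (ht : t ∈ nextRows K r₁ s) : s < t := by
  rw [nextRows] at ht
  split_ifs at ht
  · rw [Finset.mem_singleton] at ht
    omega
  · exact (Finset.mem_Ioc.mp ht).1

lemma insert_mem_routesTop {K : Finset Cell} (hK : Antitone (rowWidth K)) {r₁ s t : ℕ}
    (hs : s < r₁) (ht : t ∈ nextRows K r₁ s)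
    {b : BoxOf K} (hb : b ∈ rowBoxes K s) {R : Finset (BoxOf K)} (hR : R ∈ routesTop K r₁ t) :
    insert b R ∈ routesTop K r₁ s := by
  have hst := lt_of_mem_nextRows ht
  have hlt : ∀ z ∈ R, s < z.val.1 := fun z hz => lt_row_of_mem_routesTop hR hst hz
  rw [mem_routesTop] at hR
  obtain ⟨hroute, htop⟩ := hR
  obtain ⟨y, hy, hyt⟩ := exists_mem_topRow (nonempty_of_mem_routes hroute)
  rw [mem_routes] at hroute
  rw [mem_rowBoxes] at hb
  refine mem_routesTop.mpr ⟨mem_routes.mpr ⟨⟨?_, ?_, ?_⟩, ?_⟩, ?_⟩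
  · obtain ⟨z, hz, hz'⟩ := hroute.1.start
    exact ⟨z, Finset.mem_insert_of_mem hz, hz'⟩
  · intro z hz z' hz' h
    rw [Finset.mem_insert] at hz hz'
    rcases hz with rfl | hz <;> rcases hz' with rfl | hz'
    · rfl
    · have := hlt _ hz'
      omega
    · have := hlt _ hz
      omega
    · exact hroute.1.one_per_row _ hz _ hz' h
  · intro z hz r hr hw
    rw [Finset.mem_insert] at hz
    rcases hz with rfl | hz
    · rw [hb] at hr hw
      rw [nextRows] at ht
      split_ifs at ht with hsame
      · rw [Finset.mem_singleton] at ht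
        rcases Nat.eq_or_lt_of_le (Nat.succ_le_of_lt hr) with h1 | h1
        · exact ⟨y, Finset.mem_insert_of_mem hy, by omega⟩
        · obtain ⟨z', hz', hzr⟩ := hroute.1.no_skip y hy r (by omega)
            (by rw [hyt, htop, ht, hw, hsame])
          exact ⟨z', Finset.mem_insert_of_mem hz', hzr⟩
      · exact absurd (le_antisymm (hK (Nat.le_succ s)) (hw ▸ hK (Nat.succ_le_of_lt hr))) hsame
    · obtain ⟨z', hz', hzr⟩ := hroute.1.no_skip z hz r hr hw
      exact ⟨z', Finset.mem_insert_of_mem hz', hzr⟩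
  · intro z hz
    rw [Finset.mem_insert] at hz
    rcases hz with rfl | hz
    · omega
    · exact hroute.2 z hz
  · rw [topRow_eq (Finset.mem_insert_self b R), hb]
    intro z hz
    rw [Finset.mem_insert] at hz
    rcases hz with rfl | hz
    · exact le_rfl
    · rw [hb]
      exact (hlt z hz).le

lemma exists_eq_insert_of_mem_routesTop {K : Finset Cell} {r₁ s : ℕ} (hs : s < r₁)
    {R : Finset (BoxOf K)} (hR : R ∈ routesTop K r₁ s) :
    ∃ b ∈ rowBoxes K s, ∃ t ∈ nextRows K r₁ s, ∃ R' ∈ routesTop K r₁ t, insert b R' = R := by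
  rw [mem_routesTop] at hR
  obtain ⟨hroute, htop⟩ := hR
  obtain ⟨b, hb, hbt⟩ := exists_mem_topRow (nonempty_of_mem_routes hroute)
  rw [htop] at hbt
  rw [mem_routes] at hroute
  have hlt : ∀ z ∈ R.erase b, s < z.val.1 := by
    intro z hz
    rw [Finset.mem_erase] at hz
    have h1 := topRow_le hz.2
    refine lt_of_le_of_ne (by omega) fun h => hz.1 ?_
    exact hroute.1.one_per_row _ hz.2 _ hb (by omega)
  have hmem : R.erase b ∈ routes K r₁ := by
    refine mem_routes.mpr ⟨⟨?_, ?_, ?_⟩, ?_⟩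
    · obtain ⟨z, hz, hzr⟩ := hroute.1.start
      exact ⟨z, Finset.mem_erase.mpr ⟨by rintro rfl; omega, hz⟩, hzr⟩
    · intro z hz z' hz' h
      exact hroute.1.one_per_row _ (Finset.mem_of_mem_erase hz) _ (Finset.mem_of_mem_erase hz') h
    · intro z hz r hr hw
      obtain ⟨z', hz', hzr⟩ := hroute.1.no_skip z (Finset.mem_of_mem_erase hz) r hr hw
      have := hlt z hz
      exact ⟨z', Finset.mem_erase.mpr ⟨by rintro rfl; omega, hz'⟩, hzr⟩
    · exact fun z hz => hroute.2 z (Finset.mem_of_mem_erase hz)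
  refine ⟨b, mem_rowBoxes.mpr hbt, topRow (R.erase b), ?_, R.erase b,
    mem_routesTop.mpr ⟨hmem, rfl⟩, Finset.insert_erase hb⟩
  obtain ⟨y, hy, hyt⟩ := exists_mem_topRow (nonempty_of_mem_routes hmem)
  have hsy := hlt y hy
  rw [nextRows]
  split_ifs with hsame
  · obtain ⟨z, hz, hzr⟩ := hroute.1.no_skip b hb (s + 1) (by omega) (by rw [hbt, hsame])
    have := topRow_le (Finset.mem_erase.mpr ⟨by rintro rfl; omega, hz⟩ : z ∈ R.erase b)
    rw [Finset.mem_singleton]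
    omega
  · have := (mem_routes.mp hmem).2 y hy
    rw [Finset.mem_Ioc]
    omega

lemma sum_routesTop {K : Finset Cell} (hK : Antitone (rowWidth K)) {r₁ s : ℕ} (hs : s < r₁)
    {Q : Type*} [AddCommMonoid Q] (g : Finset (BoxOf K) → Q) :
    ∑ R ∈ routesTop K r₁ s, g R =
      ∑ b ∈ rowBoxes K s, ∑ t ∈ nextRows K r₁ s, ∑ R ∈ routesTop K r₁ t, g (insert b R) := by
  simp only [Finset.sum_sigma']
  symm
  refine Finset.sum_bij (fun p _ => insert p.1 p.2.2) ?_ ?_ ?_ (fun _ _ => rfl)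
  · rintro ⟨b, t, R⟩ hp
    simp only [Finset.mem_sigma] at hp
    exact insert_mem_routesTop hK hs hp.2.1 hp.1 hp.2.2
  · rintro ⟨b, t, R⟩ hp ⟨b', t', R'⟩ hp' heq
    simp only [Finset.mem_sigma, mem_rowBoxes] at hp hp' heq
    have hlt : ∀ z ∈ R, s < z.val.1 := fun z hz =>
      lt_row_of_mem_routesTop hp.2.2 (lt_of_mem_nextRows hp.2.1) hz
    have hlt' : ∀ z ∈ R', s < z.val.1 := fun z hz =>
      lt_row_of_mem_routesTop hp'.2.2 (lt_of_mem_nextRows hp'.2.1) hz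
    have hb : b = b' := by
      have h1 : b ∈ insert b' R' := heq ▸ Finset.mem_insert_self b R
      rcases Finset.mem_insert.mp h1 with h | h
      · exact h
      · have := hlt' b h
        omega
    subst hb
    have hR : R = R' := by
      rw [← Finset.erase_insert (fun h => (hlt b h).ne hp.1.symm : b ∉ R), heq,
        Finset.erase_insert (fun h => (hlt' b h).ne hp.1.symm)]
    subst hR
    have ht : t = t' := (mem_routesTop.mp hp.2.2).2.symm.trans (mem_routesTop.mp hp'.2.2).2
    subst ht
    rfl
  · intro R hR
    obtain ⟨b, hb, t, ht, R', hR', rfl⟩ := exists_eq_insert_of_mem_routesTop hs hR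
    exact ⟨⟨b, t, R'⟩, by simp only [Finset.mem_sigma]; exact ⟨hb, ht, hR'⟩, rfl⟩

lemma pushRow_insert {K : Finset Cell} {R : Finset (BoxOf K)} {b : BoxOf K}
    (hlt : ∀ z ∈ R, b.val.1 < z.val.1) (ρ : BoxOf K → Option ℕ) (d : Option ℕ) :
    pushRow (insert b R) ρ d = pushRow R (Function.update ρ b d) (some b.val.1) := by
  have hbR : b ∉ R := fun h => (hlt b h).false
  funext z
  by_cases hzb : z = b
  · subst hzb
    rw [pushRow, pushRow, if_pos (Finset.mem_insert_self z R), if_neg hbR, Function.update_self,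
      dif_neg]
    rintro ⟨r, hr⟩
    rw [Finset.mem_filter, Finset.mem_image] at hr
    obtain ⟨⟨y, hy, rfl⟩, hlt'⟩ := hr
    rcases Finset.mem_insert.mp hy with rfl | hy
    · exact hlt'.false
    · exact (hlt y hy).not_gt hlt'
  by_cases hz : z ∈ R
  · have hz' : z ∈ insert b R := Finset.mem_insert_of_mem hz
    have hset : ((insert b R).image fun z => z.val.1).filter (· < z.val.1) =
        insert b.val.1 ((R.image fun z => z.val.1).filter (· < z.val.1)) := by
      rw [Finset.image_insert, Finset.filter_insert, if_pos (hlt z hz)]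
    have hne : (((insert b R).image fun z => z.val.1).filter (· < z.val.1)).Nonempty := by
      rw [hset]
      exact Finset.insert_nonempty _ _
    rw [pushRow, pushRow, if_pos hz', if_pos hz, dif_pos hne]
    split_ifs with h
    · congr 1
      simp only [hset]
      rw [Finset.max'_insert _ _ h, max_eq_right]
      obtain ⟨y, hy, hyr⟩ := Finset.mem_image.mp (Finset.mem_filter.mp (Finset.max'_mem _ h)).1
      rw [← hyr]
      exact (hlt y hy).le
    · rw [Finset.not_nonempty_iff_eq_empty] at h
      congr 1
      simp only [hset, h, insert_empty_eq, Finset.max'_singleton]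
  · rw [pushRow, pushRow, if_neg hz, Function.update_of_ne hzb, if_neg]
    rw [Finset.mem_insert]
    exact fun h => h.elim hzb hz

lemma pushRow_singleton {K : Finset Cell} (b : BoxOf K) (ρ : BoxOf K → Option ℕ) (d : Option ℕ) :
    pushRow {b} ρ d = Function.update ρ b d := by
  have h := pushRow_insert (R := ∅) (b := b) (by simp) ρ d
  rw [insert_empty_eq] at h
  rw [h]
  funext z
  rw [pushRow, if_neg (Finset.notMem_empty z)]

/-! ### Coefficients of routes -/

lemma coeff1_insert_same {K : Finset Cell} {r₁ s : ℕ}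
    (hsame : rowWidth K (s + 1) = rowWidth K s) {b : BoxOf K} (hb : b.val.1 = s)
    {R : Finset (BoxOf K)} (hR : R ∈ routesTop K r₁ (s + 1)) :
    coeff1 K r₁ (insert b R) = -coeff1 K r₁ R := by
  have hbR : b ∉ R := fun h => (lt_row_of_mem_routesTop hR s.lt_succ_self h).ne hb.symm
  rw [mem_routesTop] at hR
  obtain ⟨y, hy, hyt⟩ := exists_mem_topRow (nonempty_of_mem_routes hR.1)
  have himg : (insert b R).image (fun z => rowWidth K z.val.1) =
      R.image fun z => rowWidth K z.val.1 := by
    rw [Finset.image_insert, Finset.insert_eq_of_mem]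
    exact Finset.mem_image.mpr ⟨y, hy, by rw [hyt, hR.2, hsame, hb]⟩
  rw [coeff1, coeff1, HP1, HP1, himg, Finset.card_insert_of_notMem hbR, pow_succ]
  ring

lemma coeff1_insert_new {K : Finset Cell} (hK : Antitone (rowWidth K)) {r₁ s t : ℕ}
    (hs : s < r₁) (hst : s < t)
    (hnew : rowWidth K (s + 1) ≠ rowWidth K s) {b : BoxOf K} (hb : b.val.1 = s)
    {R : Finset (BoxOf K)} (hR : R ∈ routesTop K r₁ t) :
    coeff1 K r₁ (insert b R) = -((HW K r₁ (rowWidth K s) : ℂ)⁻¹) * coeff1 K r₁ R := by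
  have hlt : ∀ z ∈ R, s < z.val.1 := fun z hz => lt_row_of_mem_routesTop hR hst hz
  have hbR : b ∉ R := fun h => (hlt b h).ne hb.symm
  have hws : ∀ r, s < r → rowWidth K r < rowWidth K s := fun r hr =>
    (hK (Nat.succ_le_of_lt hr)).trans_lt (lt_of_le_of_ne (hK s.le_succ) hnew)
  have hnot : rowWidth K s ∉
      (R.image fun z => rowWidth K z.val.1).filter fun w => rowWidth K r₁ < w := by
    rw [Finset.mem_filter, Finset.mem_image]
    rintro ⟨⟨z, hz, hzw⟩, -⟩
    exact (hws _ (hlt z hz)).ne hzw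
  rw [coeff1, coeff1, HP1, HP1, Finset.image_insert, hb, Finset.filter_insert, if_pos (hws _ hs),
    Finset.prod_insert hnot, Finset.card_insert_of_notMem hbR, pow_succ, Int.cast_mul,
    div_eq_mul_inv, div_eq_mul_inv, mul_inv]
  ring

/-! ### Chains of polarization operators as sums over routes -/

lemma polarization_word_row {K : Finset Cell} {n : ℕ} {s : ℕ} {d : Option ℕ}
    {ρ : BoxOf K → Option ℕ} (hρ : ∀ b, ρ b = some s ↔ b.val.1 = s) (T : Tab K n) :
    polarization n (some s) d (word fun b => (ρ b, T b)) =
      ∑ b ∈ rowBoxes K s, word fun z => (Function.update ρ b d z, T z) := by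
  rw [polarization_word]
  refine Finset.sum_congr ?_ fun b _ => ?_
  · ext b
    simp [mem_rowBoxes, hρ]
  · congr 1
    funext z
    by_cases hz : z = b
    · subst hz
      simp
    · simp [hz]

lemma chainMap_polarization_word {μ : YoungDiagram} (X : RemovalOn μ.cells 1) {n : ℕ} {s : ℕ}
    (hs : s ≤ (X.box 0).1) {d : Option ℕ} (hd : ∀ t, s < t → d ≠ some t)
    {ρ : BoxOf μ.cells → Option ℕ} (hρ : ∀ t, s ≤ t → ∀ b, ρ b = some t ↔ b.val.1 = t)
    (T : Tab μ.cells n) :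
    chainMap X n s (polarization n (some s) d (word fun b => (ρ b, T b))) =
      ∑ R ∈ routesTop μ.cells (X.box 0).1 s, coeff1 μ.cells (X.box 0).1 R •
        classMap X.kept n (word fun b => (pushRow R ρ d b, T b)) := by
  induction hk : (X.box 0).1 - s using Nat.strong_induction_on generalizing s d ρ with
  | _ k ih =>
  rw [polarization_word_row (hρ s le_rfl), map_sum]
  rcases Nat.eq_or_lt_of_le hs with rfl | hlt
  · rw [routesTop_self _ _ fun r hr => (rowWidth_lt_of_lt X hr).ne,
      Finset.sum_image fun _ _ _ _ h => Finset.singleton_injective h, chainMap_self]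
    refine Finset.sum_congr rfl fun b hb => ?_
    have hc : coeff1 μ.cells (X.box 0).1 {b} = -1 := by
      rw [coeff1, HP1, Finset.image_singleton, mem_rowBoxes.mp hb, Finset.filter_singleton,
        if_neg (lt_irrefl _)]
      simp
    rw [hc, pushRow_singleton, neg_one_smul]
    rfl
  · rw [sum_routesTop (rowWidth_anti μ) hlt]
    refine Finset.sum_congr rfl fun b hb => ?_
    have hbs := mem_rowBoxes.mp hb
    have hnext : ∀ t, s < t → t ≤ (X.box 0).1 →
        chainMap X n t (polarization n (some t) (some s)
          (word fun z => (Function.update ρ b d z, T z))) =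
        ∑ R ∈ routesTop μ.cells (X.box 0).1 t, coeff1 μ.cells (X.box 0).1 R •
          classMap X.kept n (word fun z => (pushRow (insert b R) ρ d z, T z)) := by
      intro t hst ht
      rw [ih ((X.box 0).1 - t) (by omega) ht (fun t' h h' => by
        rw [Option.some.injEq] at h'; omega) (fun t' ht' z => ?_) rfl]
      · refine Finset.sum_congr rfl fun R hR => ?_
        rw [pushRow_insert (fun z hz => hbs ▸ lt_row_of_mem_routesTop hR hst hz) ρ d, hbs]
      · by_cases hz : z = b
        · subst hz
          rw [Function.update_self]
          exact ⟨fun h => absurd h (hd t' (by omega)), fun h => by omega⟩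
        · rw [Function.update_of_ne hz]
          exact hρ t' (by omega) z
    by_cases hsame : rowWidth μ.cells (s + 1) = rowWidth μ.cells s
    · rw [chainMap_same X n hlt hsame, hnext (s + 1) s.lt_succ_self hlt, nextRows, if_pos hsame,
        Finset.sum_singleton, ← Finset.sum_neg_distrib]
      refine Finset.sum_congr rfl fun R hR => ?_
      rw [coeff1_insert_same hsame hbs hR, neg_smul]
    · rw [chainMap_new X n hlt hsame, nextRows, if_neg hsame, Finset.smul_sum]
      refine Finset.sum_congr rfl fun t ht => ?_
      rw [Finset.mem_Ioc] at ht
      rw [hnext t ht.1 ht.2, Finset.smul_sum]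
      refine Finset.sum_congr rfl fun R hR => ?_
      rw [coeff1_insert_new (rowWidth_anti μ) hlt ht.1 hsame hbs hR, smul_smul]

lemma sum_chainMap_word {μ : YoungDiagram} (X : RemovalOn μ.cells 1) {n : ℕ}
    (T : Tab μ.cells n) :
    ∑ s ∈ Finset.range ((X.box 0).1 + 1),
        chainMap X n s (polarization n (some s) none (word fun b => (some b.val.1, T b))) =
      ∑ R ∈ routes μ.cells (X.box 0).1, coeff1 μ.cells (X.box 0).1 R •
        classMap X.kept n (word fun b => (pushRow R (fun z => some z.val.1) none b, T b)) := by
  rw [← Finset.sum_fiberwise_of_maps_to (s := routes μ.cells (X.box 0).1)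
    (t := Finset.range ((X.box 0).1 + 1)) (g := topRow)]
  · refine Finset.sum_congr rfl fun s hs => ?_
    exact chainMap_polarization_word X (Nat.lt_succ_iff.mp (Finset.mem_range.mp hs))
      (fun t _ h => by cases h) (fun t _ b => by rw [Option.some.injEq]) T
  · intro R hR
    obtain ⟨b, hb, hbt⟩ := exists_mem_topRow (nonempty_of_mem_routes hR)
    have := (mem_routes.mp hR).2 b hb
    rw [Finset.mem_range]
    omega

/-! ### Paths are determined by their routes -/

/-- The box `x₁`. -/
def cornerBox {K : Finset Cell} (X : RemovalOn K 1) : BoxOf K := ⟨X.box 0, X.mem 0⟩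

/-- The set `R ∪ Y`. -/
def routeSet {K : Finset Cell} (R : Finset (BoxOf K)) : Set (PB K 1) :=
  {z | (∃ b ∈ R, z = Sum.inl b) ∨ z = Sum.inr 0}

/-- `z` is the lowest element of `R ∪ Y` strictly above row `r`. -/
structure IsNext {K : Finset Cell} (R : Finset (BoxOf K)) (r : ℕ) (z : PB K 1) : Prop where
  mem : z ∈ routeSet R
  lt : lowVal z < r
  le : ∀ z' ∈ routeSet R, lowVal z' < r → lowVal z' ≤ lowVal z

/-- `P` moves every box of `R` to the next box of `R ∪ Y`, moves `x₁` to the lowest box of `R`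
if it is not in `R`, and fixes everything else. -/
structure IsRouteMap {K : Finset Cell} (X : RemovalOn K 1) (P : PB K 1 → PB K 1)
    (R : Finset (BoxOf K)) : Prop where
  next : ∀ b ∈ R, IsNext R b.val.1 (P (Sum.inl b))
  start : cornerBox X ∉ R → ∃ b ∈ R, b.val.1 = (X.box 0).1 ∧ P (Sum.inl (cornerBox X)) = Sum.inl b
  fix_y : P (Sum.inr 0) = Sum.inr 0
  fix_out : ∀ b, b ∉ R → b ≠ cornerBox X → P (Sum.inl b) = Sum.inl b

lemma lowVal_inl {K : Finset Cell} {m : ℕ} (b : BoxOf K) :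
    lowVal (Sum.inl b : PB K m) = b.val.1 := rfl

lemma lowVal_inr_zero {K : Finset Cell} : lowVal (Sum.inr 0 : PB K 1) = -1 := by
  simp [lowVal]

lemma inl_mem_routeSet {K : Finset Cell} {R : Finset (BoxOf K)} {b : BoxOf K} :
    (Sum.inl b : PB K 1) ∈ routeSet R ↔ b ∈ R := by
  constructor
  · rintro (⟨c, hc, he⟩ | he)
    · rwa [Sum.inl_injective he]
    · cases he
  · exact fun hb => Or.inl ⟨b, hb, rfl⟩

lemma inr_mem_routeSet {K : Finset Cell} (R : Finset (BoxOf K)) :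
    (Sum.inr 0 : PB K 1) ∈ routeSet R := Or.inr rfl

lemma lowVal_injOn {K : Finset Cell} {R : Finset (BoxOf K)}
    (hR : ∀ b ∈ R, ∀ b' ∈ R, b.val.1 = b'.val.1 → b = b') : Set.InjOn lowVal (routeSet R) := by
  rintro z (⟨b, hb, rfl⟩ | rfl) z' (⟨b', hb', rfl⟩ | rfl) h
  · rw [lowVal_inl, lowVal_inl] at h
    rw [hR b hb b' hb' (by omega)]
  · rw [lowVal_inl, lowVal_inr_zero] at h
    omega
  · rw [lowVal_inl, lowVal_inr_zero] at h
    omega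
  · rfl

lemma IsNext.unique {K : Finset Cell} {R : Finset (BoxOf K)}
    (hR : ∀ b ∈ R, ∀ b' ∈ R, b.val.1 = b'.val.1 → b = b') {r : ℕ} {z z' : PB K 1}
    (h : IsNext R r z) (h' : IsNext R r z') : z = z' :=
  lowVal_injOn hR h.mem h'.mem (le_antisymm (h'.le z h.mem h.lt) (h.le z' h'.mem h'.lt))

lemma exists_isNext {K : Finset Cell} (R : Finset (BoxOf K)) (r : ℕ) :
    ∃ z : PB K 1, IsNext R r z := by
  have hfin : ({z | z ∈ routeSet R ∧ lowVal z < r} : Set (PB K 1)).Finite := Set.toFinite _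
  obtain ⟨z, hz, hmax⟩ := hfin.exists_maximalFor lowVal _
    ⟨Sum.inr 0, inr_mem_routeSet R, by rw [lowVal_inr_zero]; omega⟩
  refine ⟨z, hz.1, hz.2, fun z' hz' hlt => ?_⟩
  by_contra! hcon
  exact (hmax ⟨hz', hlt⟩ hcon.le).not_gt hcon

lemma mem_orb {K : Finset Cell} {X : RemovalOn K 1} {P : PB K 1 → PB K 1} {z : PB K 1} :
    z ∈ orb X P 0 ↔ ∃ j : ℕ, P^[j] (Sum.inl (cornerBox X)) = z := Iff.rfl

lemma lowVal_iterate_le {K : Finset Cell} {P : PB K 1 → PB K 1}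
    (hP : ∀ z, lowVal (P z) ≤ lowVal z) (j : ℕ) (z : PB K 1) : lowVal (P^[j] z) ≤ lowVal z := by
  induction j with
  | zero => exact le_rfl
  | succ j ih =>
    rw [Function.iterate_succ_apply']
    exact (hP _).trans ih

namespace IsMPath

variable {K : Finset Cell} {X : RemovalOn K 1} {P : PB K 1 → PB K 1} {R : Finset (BoxOf K)}

lemma orb_eq (h : IsMPath X P R) {z : PB K 1} :
    z ∈ orb X P 0 ↔ z ∈ routeSet R ∨ z = Sum.inl (cornerBox X) := by
  have h0 : z ∈ orb X P 0 ↔ z ∈ ⋃ i, orb X P i := by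
    rw [Set.mem_iUnion]
    exact ⟨fun hz => ⟨0, hz⟩, fun ⟨i, hi⟩ => Subsingleton.elim i 0 ▸ hi⟩
  rw [h0, h.orb_union]
  simp only [routeSet, Fin.exists_fin_one, cornerBox]
  constructor
  · rintro (h | h | h)
    exacts [Or.inl (Or.inl h), Or.inr h, Or.inl (Or.inr h)]
  · rintro ((h | h) | h)
    exacts [Or.inl h, Or.inr (Or.inr h), Or.inr (Or.inl h)]

lemma apply_mem_routeSet (h : IsMPath X P R) {b : BoxOf K} (hb : b ∈ R ∨ b = cornerBox X) :
    P (Sum.inl b) ∈ routeSet R := by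
  have hmem : P (Sum.inl b) ∈ (fun b : BoxOf K => P (Sum.inl b)) ''
      {b : BoxOf K | b ∈ R ∨ ∃ i, b.val = X.box i} :=
    ⟨b, hb.imp_right fun hb => ⟨0, congrArg Subtype.val hb⟩, rfl⟩
  rw [h.image_route] at hmem
  rcases hmem with ⟨z, hz, hzP⟩ | ⟨i, hi⟩
  · exact Or.inl ⟨z, hz.1, hzP.symm⟩
  · exact Or.inr (by rw [← hi, Subsingleton.elim i 0])

/-- An element of `R ∪ Y` which is not reached weakly before `P z` in the orbit lies weakly
above `P z`. -/
lemma lowVal_le_apply (h : IsMPath X P R) {z z' : PB K 1} (hz : z ∈ orb X P 0)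
    (hz' : z' ∈ orb X P 0) (hlt : lowVal z' < lowVal z) : lowVal z' ≤ lowVal (P z) := by
  obtain ⟨i, rfl⟩ := mem_orb.mp hz
  obtain ⟨j, rfl⟩ := mem_orb.mp hz'
  have hij : i < j := by
    by_contra! hji
    obtain ⟨k, rfl⟩ := Nat.exists_eq_add_of_le hji
    rw [add_comm, Function.iterate_add_apply] at hlt
    exact (lowVal_iterate_le h.mono k _).not_gt hlt
  obtain ⟨k, rfl⟩ := Nat.exists_eq_add_of_le hij
  rw [add_comm, Function.iterate_add_apply, Function.iterate_succ_apply' P i]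
  exact lowVal_iterate_le h.mono k _

lemma route_mem_routes (h : IsMPath X P R) : R ∈ routes K (X.box 0).1 := by
  refine mem_routes.mpr ⟨h.route, fun b hb => ?_⟩
  obtain ⟨j, hj⟩ := mem_orb.mp (h.orb_eq.mpr (Or.inl (inl_mem_routeSet.mpr hb)))
  have := lowVal_iterate_le h.mono j (Sum.inl (cornerBox X))
  rw [hj, lowVal_inl, lowVal_inl] at this
  exact_mod_cast this

lemma isRouteMap (h : IsMPath X P R) : IsRouteMap X P R where
  next b hb := by
    refine ⟨h.apply_mem_routeSet (Or.inl hb), h.strict_on_route b hb, fun z' hz' hlt => ?_⟩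
    exact h.lowVal_le_apply (h.orb_eq.mpr (Or.inl (inl_mem_routeSet.mpr hb)))
      (h.orb_eq.mpr (Or.inl hz')) hlt
  start hx := by
    obtain ⟨b, hb, hbr⟩ := h.route.start
    refine ⟨b, hb, hbr, ?_⟩
    refine lowVal_injOn h.route.one_per_row (h.apply_mem_routeSet (Or.inr rfl))
      (inl_mem_routeSet.mpr hb) (le_antisymm ?_ ?_)
    · refine (h.mono _).trans_eq ?_
      rw [lowVal_inl, lowVal_inl, hbr]
      rfl
    · obtain ⟨j, hj⟩ := mem_orb.mp (h.orb_eq.mpr (Or.inl (inl_mem_routeSet.mpr hb)))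
      cases j with
      | zero =>
        rw [Function.iterate_zero, id, Sum.inl.injEq] at hj
        exact absurd (hj ▸ hb) hx
      | succ j =>
        rw [← hj, Function.iterate_succ_apply]
        exact lowVal_iterate_le h.mono j _
  fix_y := h.fix_y 0
  fix_out b hb hx := h.fix_out b hb fun i hi => hx (Subtype.ext (by
    rw [hi, Subsingleton.elim i 0]
    rfl))

end IsMPath

lemma IsRouteMap.unique {K : Finset Cell} {X : RemovalOn K 1} {P P' : PB K 1 → PB K 1}
    {R : Finset (BoxOf K)} (hR : R ∈ routes K (X.box 0).1) (h : IsRouteMap X P R)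
    (h' : IsRouteMap X P' R) : P = P' := by
  have hone := (mem_routes.mp hR).1.one_per_row
  funext z
  rcases z with b | i
  · by_cases hb : b ∈ R
    · exact (h.next b hb).unique hone (h'.next b hb)
    by_cases hx : b = cornerBox X
    · subst hx
      obtain ⟨c, hc, hcr, hP⟩ := h.start hb
      obtain ⟨c', hc', hcr', hP'⟩ := h'.start hb
      rw [hP, hP', hone c hc c' hc' (by rw [hcr, hcr'])]
    · rw [h.fix_out b hb hx, h'.fix_out b hb hx]
  · rw [Subsingleton.elim i 0, h.fix_y, h'.fix_y]

lemma exists_isRouteMap {K : Finset Cell} (X : RemovalOn K 1) {R : Finset (BoxOf K)}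
    (hR : R ∈ routes K (X.box 0).1) : ∃ P, IsRouteMap X P R := by
  choose nx hnx using fun r : ℕ => exists_isNext R r
  obtain ⟨b₀, hb₀, hb₀r⟩ := (mem_routes.mp hR).1.start
  refine ⟨Sum.elim (fun b => if b ∈ R then nx b.val.1 else
    if b = cornerBox X then Sum.inl b₀ else Sum.inl b) Sum.inr, ⟨?_, ?_, rfl, ?_⟩⟩
  · intro b hb
    rw [Sum.elim_inl, if_pos hb]
    exact hnx _
  · intro hx
    exact ⟨b₀, hb₀, hb₀r, by rw [Sum.elim_inl, if_neg hx, if_pos rfl]⟩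
  · intro b hb hx
    rw [Sum.elim_inl, if_neg hb, if_neg hx]

namespace IsRouteMap

variable {K : Finset Cell} {X : RemovalOn K 1} {P : PB K 1 → PB K 1} {R : Finset (BoxOf K)}

lemma exists_prev (h : IsRouteMap X P R) (hR : R ∈ routes K (X.box 0).1) {z : PB K 1}
    (hz : z ∈ routeSet R) (hlt : lowVal z < (X.box 0).1) :
    ∃ b ∈ R, lowVal z < b.val.1 ∧ P (Sum.inl b) = z := by
  have hone := (mem_routes.mp hR).1.one_per_row
  obtain ⟨b₀, hb₀, hb₀r⟩ := (mem_routes.mp hR).1.start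
  obtain ⟨b, hb, hmin⟩ := (R.filter fun b => lowVal z < b.val.1).exists_min_image
    (fun b => b.val.1) ⟨b₀, Finset.mem_filter.mpr ⟨hb₀, by rwa [hb₀r]⟩⟩
  rw [Finset.mem_filter] at hb
  refine ⟨b, hb.1, hb.2, (h.next b hb.1).unique hone ⟨hz, hb.2, ?_⟩⟩
  rintro z' (⟨b', hb', rfl⟩ | rfl) hlt'
  · by_contra! hcon
    have := hmin b' (Finset.mem_filter.mpr ⟨hb', hcon⟩)
    rw [lowVal_inl] at hlt'
    omega
  · rw [lowVal_inr_zero]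
    rcases hz with ⟨b', -, rfl⟩ | rfl
    · rw [lowVal_inl]
      omega
    · rw [lowVal_inr_zero]

lemma corner_apply (h : IsRouteMap X P R) (hR : R ∈ routes K (X.box 0).1)
    {b : BoxOf K} (hb : b ∈ R) (hbr : b.val.1 = (X.box 0).1) (hx : b ≠ cornerBox X) :
    P (Sum.inl (cornerBox X)) = Sum.inl b := by
  have hone := (mem_routes.mp hR).1.one_per_row
  obtain ⟨c, hc, hcr, hP⟩ := h.start fun hxR => hx (hone b hb _ hxR hbr)
  rw [hP, hone c hc b hb (by rw [hcr, hbr])]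

/-- Every box of `(R ∖ X) ∪ Y` is the image of a box of `R ∪ X`. -/
lemma exists_preimage (h : IsRouteMap X P R) (hR : R ∈ routes K (X.box 0).1) {z : PB K 1}
    (hz : z ∈ routeSet R) (hx : z ≠ Sum.inl (cornerBox X)) :
    ∃ b, (b ∈ R ∨ b = cornerBox X) ∧ P (Sum.inl b) = z := by
  by_cases hlt : lowVal z < (X.box 0).1
  · obtain ⟨b, hb, -, hP⟩ := h.exists_prev hR hz hlt
    exact ⟨b, Or.inl hb, hP⟩
  · rcases hz with ⟨b, hb, rfl⟩ | rfl
    · have hle := (mem_routes.mp hR).2 b hb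
      rw [lowVal_inl] at hlt
      exact ⟨_, Or.inr rfl, h.corner_apply hR hb (by omega) fun he => hx (by rw [he])⟩
    · rw [lowVal_inr_zero] at hlt
      omega

lemma apply_mem (h : IsRouteMap X P R) {b : BoxOf K} (hb : b ∈ R ∨ b = cornerBox X) :
    P (Sum.inl b) ∈ routeSet R := by
  by_cases hbR : b ∈ R
  · exact (h.next b hbR).mem
  · obtain rfl := hb.resolve_left hbR
    obtain ⟨c, hc, -, hP⟩ := h.start hbR
    rw [hP]
    exact inl_mem_routeSet.mpr hc

lemma apply_ne_corner (h : IsRouteMap X P R) (hR : R ∈ routes K (X.box 0).1) {b : BoxOf K}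
    (hb : b ∈ R ∨ b = cornerBox X) : P (Sum.inl b) ≠ Sum.inl (cornerBox X) := by
  intro he
  by_cases hbR : b ∈ R
  · have hlt := (h.next b hbR).lt
    have hle := (mem_routes.mp hR).2 b hbR
    rw [he, lowVal_inl] at hlt
    change ((X.box 0).1 : ℤ) < _ at hlt
    omega
  · have hbx := hb.resolve_left hbR
    rw [hbx] at hbR he
    obtain ⟨c, hc, -, hP⟩ := h.start hbR
    rw [hP, Sum.inl.injEq] at he
    exact hbR (he ▸ hc)

lemma mono (h : IsRouteMap X P R) (z : PB K 1) : lowVal (P z) ≤ lowVal z := by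
  rcases z with b | i
  · by_cases hb : b ∈ R
    · exact (h.next b hb).lt.le
    by_cases hx : b = cornerBox X
    · subst hx
      obtain ⟨c, -, hcr, hP⟩ := h.start hb
      rw [hP, lowVal_inl, hcr]
      exact le_rfl
    · rw [h.fix_out b hb hx]
  · rw [Subsingleton.elim i 0, h.fix_y]

lemma orb_eq (h : IsRouteMap X P R) (hR : R ∈ routes K (X.box 0).1) {z : PB K 1} :
    z ∈ orb X P 0 ↔ z ∈ routeSet R ∨ z = Sum.inl (cornerBox X) := by
  constructor
  · rw [mem_orb]
    rintro ⟨j, rfl⟩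
    induction j with
    | zero => exact Or.inr rfl
    | succ j ih =>
      rw [Function.iterate_succ_apply']
      rcases ih with (⟨b, hb, he⟩ | he) | he
      · rw [he]
        exact Or.inl (h.apply_mem (Or.inl hb))
      · rw [he, h.fix_y]
        exact Or.inl (inr_mem_routeSet R)
      · rw [he]
        exact Or.inl (h.apply_mem (Or.inr rfl))
  · have hstep : ∀ {y : PB K 1}, y ∈ orb X P 0 → P y ∈ orb X P 0 := fun ⟨j, hj⟩ =>
      ⟨j + 1, by rw [Function.iterate_succ_apply', hj]⟩
    have hx : (Sum.inl (cornerBox X) : PB K 1) ∈ orb X P 0 := ⟨0, rfl⟩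
    rintro (hz | rfl)
    · induction hk : ((X.box 0).1 - lowVal z).toNat using Nat.strong_induction_on
        generalizing z with
      | _ k ih =>
      by_cases hlt : lowVal z < (X.box 0).1
      · obtain ⟨b, hb, hzb, hP⟩ := h.exists_prev hR hz hlt
        rw [← hP]
        refine hstep (ih _ ?_ (inl_mem_routeSet.mpr hb) rfl)
        rw [lowVal_inl]
        omega
      · by_cases hzx : z = Sum.inl (cornerBox X)
        · rwa [hzx]
        rcases hz with ⟨b, hb, rfl⟩ | rfl
        · have hle := (mem_routes.mp hR).2 b hb
          rw [lowVal_inl] at hlt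
          rw [← h.corner_apply hR hb (by omega) fun he => hzx (by rw [he])]
          exact hstep hx
        · rw [lowVal_inr_zero] at hlt
          omega
    · exact hx

lemma isMPath (h : IsRouteMap X P R) (hR : R ∈ routes K (X.box 0).1) : IsMPath X P R where
  route := (mem_routes.mp hR).1
  mono := h.mono
  strict_on_route b hb := (h.next b hb).lt
  y_mem i := by
    rw [Subsingleton.elim i 0]
    exact (h.orb_eq hR).mpr (Or.inl (inr_mem_routeSet R))
  orb_union := by
    ext z
    rw [Set.mem_iUnion, Fin.exists_fin_one, h.orb_eq hR]
    simp only [routeSet, Fin.exists_fin_one, cornerBox]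
    constructor
    · rintro ((h | h) | h)
      exacts [Or.inl h, Or.inr (Or.inr h), Or.inr (Or.inl h)]
    · rintro (h | h | h)
      exacts [Or.inl (Or.inl h), Or.inr h, Or.inl (Or.inr h)]
  orb_disjoint i j hij := absurd (Subsingleton.elim i j) hij
  interlace w hw := by
    refine ⟨0, fun i _ j _ _ => Subsingleton.elim i j, fun i hi => ⟨?_, ?_⟩⟩
    · exact (Set.ncard_pos (Set.toFinite _)).mpr ⟨i, hi⟩
    rw [Subsingleton.elim i 0] at hi ⊢
    obtain ⟨c₀, hc₀, hc₀w⟩ := hi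
    obtain ⟨c, hc, hmax⟩ := (Finset.univ.filter fun c : BoxOf K =>
      Sum.inl c ∈ orb X P 0 ∧ rowWidth K c.val.1 = w).exists_max_image (fun c => c.val.1)
      ⟨c₀, by simp only [Finset.mem_filter, Finset.mem_univ, true_and]; exact ⟨hc₀, hc₀w⟩⟩
    simp only [Finset.mem_filter, Finset.mem_univ, true_and] at hc hmax
    refine ⟨c, hc.1, hc.2, ?_⟩
    rw [Pi.zero_apply, Finset.card_eq_zero, Finset.filter_eq_empty_iff]
    rintro r - ⟨hcr, hrw⟩
    obtain ⟨c', hc', hrow⟩ : ∃ c' ∈ R, c'.val.1 = c.val.1 := by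
      rcases (h.orb_eq hR).mp hc.1 with hcR | hcx
      · exact ⟨c, inl_mem_routeSet.mp hcR, rfl⟩
      · obtain ⟨b, hb, hbr⟩ := (mem_routes.mp hR).1.start
        rw [Sum.inl.injEq] at hcx
        exact ⟨b, hb, by rw [hcx, hbr]; rfl⟩
    obtain ⟨b, hb, hbr⟩ := (mem_routes.mp hR).1.no_skip c' hc' r (by omega)
      (by rw [hrow, hrw, hc.2])
    have := hmax b ⟨(h.orb_eq hR).mpr (Or.inl (inl_mem_routeSet.mpr hb)), by rw [hbr, hrw]⟩
    omega
  row_order b hb b' hb' c c' _ hlt hc hc' _ _ := by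
    have h1 := (h.next b' hb').lt
    have h2 := (h.next b hb).le (Sum.inl b') (inl_mem_routeSet.mpr hb')
      (by rw [lowVal_inl]; exact_mod_cast hlt)
    rw [hc', lowVal_inl] at h1
    rw [hc, lowVal_inl, lowVal_inl] at h2
    omega
  fix_y i := by rw [Subsingleton.elim i 0, h.fix_y]
  fix_out b hb hx := h.fix_out b hb fun he => hx 0 (by rw [he]; rfl)
  image_route := by
    have hcorner : ∀ b : BoxOf K, (∃ i, b.val = X.box i) ↔ b = cornerBox X := fun b => by
      rw [Fin.exists_fin_one, Subtype.ext_iff]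
      rfl
    have hcorner' : ∀ b : BoxOf K, (∀ i, b.val ≠ X.box i) ↔ b ≠ cornerBox X := fun b => by
      rw [Ne, ← hcorner, not_exists]
    simp only [hcorner, hcorner']
    ext z
    constructor
    · rintro ⟨b, hb, rfl⟩
      have hne := h.apply_ne_corner hR hb
      rcases h.apply_mem hb with ⟨c, hc, he⟩ | he
      · refine Or.inl ⟨c, ⟨hc, fun hcx => hne ?_⟩, he.symm⟩
        rw [he, hcx]
      · exact Or.inr ⟨0, he.symm⟩
    · rintro (⟨c, ⟨hc, hcx⟩, rfl⟩ | ⟨i, rfl⟩)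
      · exact h.exists_preimage hR (inl_mem_routeSet.mpr hc) fun he => hcx (Sum.inl_injective he)
      · rw [Subsingleton.elim i 0]
        exact h.exists_preimage hR (inr_mem_routeSet R) (by simp)

end IsRouteMap

lemma sum_MPath {K : Finset Cell} (X : RemovalOn K 1) {Q : Type*} [AddCommMonoid Q]
    {f : MPath X → Q} {g : Finset (BoxOf K) → Q} (hfg : ∀ P : MPath X, f P = g P.route) :
    ∑ P : MPath X, f P = ∑ R ∈ routes K (X.box 0).1, g R := by
  refine Finset.sum_bij (fun P _ => P.route) ?_ ?_ ?_ fun P _ => hfg P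
  · exact fun P _ => P.2.route_mem_routes
  · rintro ⟨⟨P, R⟩, h⟩ _ ⟨⟨P', R'⟩, h'⟩ _ he
    obtain rfl : R = R' := he
    obtain rfl : P = P' := h.isRouteMap.unique h.route_mem_routes h'.isRouteMap
    rfl
  · intro R hR
    obtain ⟨P, hP⟩ := exists_isRouteMap X hR
    exact ⟨⟨⟨P, R⟩, hP.isMPath hR⟩, Finset.mem_univ _, rfl⟩

/-! ### Boxes of the shape and boxes of the image of a path -/

/-- The inclusion of `(λ ∖ X) ∪ Y` into `λ ∪ Y`. -/
def keptIncl {K : Finset Cell} (X : RemovalOn K 1) : Option (BoxOf X.kept) → PB K 1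
  | none => Sum.inr 0
  | some z => Sum.inl ⟨z.val, kept_subset X z.2⟩

lemma keptIncl_injective {K : Finset Cell} (X : RemovalOn K 1) :
    Function.Injective (keptIncl X) := by
  rintro (_ | z) (_ | z') h
  · rfl
  · simp [keptIncl] at h
  · simp [keptIncl] at h
  · rw [keptIncl, keptIncl, Sum.inl.injEq, Subtype.mk.injEq] at h
    rw [Subtype.ext h]

lemma map_pinv {K : Finset Cell} {X : RemovalOn K 1} {P : PB K 1 → PB K 1}
    {R : Finset (BoxOf K)} (h : IsMPath X P R) (o : Option (BoxOf X.kept)) :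
    P (Sum.inl (pinv X P (keptIncl X o))) = keptIncl X o := by
  have h' := h.isRouteMap
  have hR := h.route_mem_routes
  have hex : ∃ b, P (Sum.inl b) = keptIncl X o := by
    have hne : keptIncl X o ≠ Sum.inl (cornerBox X) := by
      cases o with
      | none => simp [keptIncl]
      | some z =>
        rw [keptIncl, Ne, Sum.inl.injEq, cornerBox, Subtype.mk.injEq]
        exact (mem_kept.mp z.2).2
    by_cases hmem : keptIncl X o ∈ routeSet R
    · obtain ⟨b, -, hb⟩ := h'.exists_preimage hR hmem hne
      exact ⟨b, hb⟩
    · cases o with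
      | none => exact absurd (inr_mem_routeSet R) hmem
      | some z =>
        rw [keptIncl] at hmem hne ⊢
        rw [inl_mem_routeSet] at hmem
        exact ⟨_, h'.fix_out _ hmem fun he => hne (by rw [he])⟩
  exact @Function.invFun_eq _ _ ⟨cornerBox X⟩ (fun b => P (Sum.inl b)) _ hex

/-- The bijection between `(λ ∖ X) ∪ Y` and `λ` given by the inverse of a path. -/
def MPath.boxEquiv {K : Finset Cell} {X : RemovalOn K 1} (P : MPath X) :
    Option (BoxOf X.kept) ≃ BoxOf K :=
  Equiv.ofBijective (fun o => pinv X P.map (keptIncl X o)) <| by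
    rw [Fintype.bijective_iff_injective_and_card]
    refine ⟨fun o o' h => keptIncl_injective X ?_, ?_⟩
    · rw [← map_pinv P.2 o, ← map_pinv P.2 o']
      exact congrArg (fun b => P.map (Sum.inl b)) h
    · rw [Fintype.card_option, Fintype.card_coe, Fintype.card_coe, kept_eq_erase,
        Finset.card_erase_add_one (X.mem 0)]

lemma MPath.map_boxEquiv {K : Finset Cell} {X : RemovalOn K 1} (P : MPath X)
    (o : Option (BoxOf X.kept)) : P.map (Sum.inl (P.boxEquiv o)) = keptIncl X o := map_pinv P.2 o

lemma pact1_eq {K : Finset Cell} {n : ℕ} {X : RemovalOn K 1} (T : Tab K n) (P : MPath X) :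
    pact1 X T P.map = stdv n (T (P.boxEquiv none)) ⊗ₜ[ℂ]
      Finsupp.single (fun z => T (P.boxEquiv (some z))) 1 := rfl

lemma IsNext.pushRow_eq {K : Finset Cell} {R : Finset (BoxOf K)} {b : BoxOf K} (hb : b ∈ R)
    {ρ : BoxOf K → Option ℕ} {z : PB K 1} (h : IsNext R b.val.1 z) :
    pushRow R ρ none b = Sum.elim (fun y => some y.val.1) (fun _ => none) z := by
  rw [pushRow, if_pos hb]
  obtain ⟨hz, hlt, hle⟩ := h
  rcases hz with ⟨y, hy, rfl⟩ | rfl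
  · rw [lowVal_inl, Nat.cast_lt] at hlt
    have hmem : y.val.1 ∈ (R.image fun z => z.val.1).filter (· < b.val.1) :=
      Finset.mem_filter.mpr ⟨Finset.mem_image.mpr ⟨y, hy, rfl⟩, hlt⟩
    rw [dif_pos ⟨_, hmem⟩, Sum.elim_inl]
    congr 1
    refine le_antisymm (Finset.max'_le _ _ _ fun r hr => ?_) (Finset.le_max' _ _ hmem)
    rw [Finset.mem_filter, Finset.mem_image] at hr
    obtain ⟨⟨y', hy', rfl⟩, hlt'⟩ := hr
    have := hle (Sum.inl y') (inl_mem_routeSet.mpr hy') (by rw [lowVal_inl]; exact_mod_cast hlt')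
    rw [lowVal_inl, lowVal_inl] at this
    exact_mod_cast this
  · rw [Sum.elim_inr, dif_neg]
    rintro ⟨r, hr⟩
    rw [Finset.mem_filter, Finset.mem_image] at hr
    obtain ⟨⟨y', hy', rfl⟩, hlt'⟩ := hr
    have := hle (Sum.inl y') (inl_mem_routeSet.mpr hy') (by rw [lowVal_inl]; exact_mod_cast hlt')
    rw [lowVal_inl, lowVal_inr_zero] at this
    omega

lemma pushRow_boxEquiv {K : Finset Cell} {X : RemovalOn K 1} (P : MPath X)
    (o : Option (BoxOf X.kept)) :
    pushRow P.route (fun z => some z.val.1) none (P.boxEquiv o) = rowOpt o := by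
  have h := P.2.isRouteMap
  have ho : Sum.elim (fun y => some y.val.1) (fun _ => none) (keptIncl X o) = rowOpt o := by
    cases o <;> rfl
  rw [← ho, ← P.map_boxEquiv o]
  by_cases hb : P.boxEquiv o ∈ P.route
  · exact (h.next _ hb).pushRow_eq hb
  · rw [pushRow, if_neg hb]
    by_cases hx : P.boxEquiv o = cornerBox X
    · rw [hx] at hb ⊢
      obtain ⟨c, -, hcr, hP⟩ := h.start hb
      rw [show P.map (Sum.inl (cornerBox X)) = Sum.inl c from hP, Sum.elim_inl, hcr]
      rfl
    · rw [show P.map (Sum.inl (P.boxEquiv o)) = Sum.inl (P.boxEquiv o) from h.fix_out _ hb hx,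
        Sum.elim_inl]

lemma mkQ_pact1 {K : Finset Cell} {n : ℕ} {X : RemovalOn K 1} (T : Tab K n) (P : MPath X) :
    (tensR (Fin n → ℂ) X.kept n).mkQ (pact1 X T P.map) =
      classMap X.kept n
        (word fun b => (pushRow P.route (fun z => some z.val.1) none b, T b)) := by
  rw [pact1_eq, ← word_comp_equiv P.boxEquiv]
  have hw : (fun b => (pushRow P.route (fun z => some z.val.1) none b, T b)) ∘ P.boxEquiv =
      fun o => (rowOpt o, T (P.boxEquiv o)) := by
    funext o
    rw [Function.comp_apply, pushRow_boxEquiv]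
  rw [hw]
  exact (classMap_tabWord fun o => T (P.boxEquiv o)).symm

/-! ### The image of the Garnir relations -/

/-- The monomial of a tableau. -/
def rowWord {K : Finset Cell} {n : ℕ} (T : Tab K n) : RowPoly n :=
  word fun b => (some b.val.1, T b)

lemma Phi1_single {K : Finset Cell} (X : RemovalOn K 1) {n : ℕ} (T : Tab K n) :
    Phi1 X n (Finsupp.single T 1) =
      ∑ P : MPath X, coeff1 K (X.box 0).1 P.route • pact1 X T P.map := by
  simp [Phi1]

lemma mkQ_Phi1_single {μ : YoungDiagram} (X : RemovalOn μ.cells 1) {n : ℕ} (T : Tab μ.cells n) :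
    (tensR (Fin n → ℂ) X.kept n).mkQ (Phi1 X n (Finsupp.single T 1)) =
      ∑ s ∈ Finset.range ((X.box 0).1 + 1),
        chainMap X n s (polarization n (some s) none (rowWord T)) := by
  rw [rowWord, sum_chainMap_word, Phi1_single, map_sum]
  exact sum_MPath X fun P => by rw [map_smul, mkQ_pact1]

lemma rowWord_eq_of_rowEquiv {K : Finset Cell} {n : ℕ} {T₁ T₂ : Tab K n} (h : RowEquiv T₁ T₂) :
    rowWord T₁ = rowWord T₂ := by
  obtain ⟨σ, hσ, rfl⟩ := h
  rw [rowWord, rowWord, ← word_comp_equiv σ fun b => (some b.val.1, permAct σ T₁ b)]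
  congr 1
  funext b
  rw [Function.comp_apply, hσ, permAct]
  exact congrArg (fun z => (some b.val.1, T₁ z)) (σ.symm_apply_apply b).symm

/-- The image of a tableau under `Φ₁` satisfies the exchange relations. -/
lemma sum_mkQ_Phi1_swap {μ : YoungDiagram} (X : RemovalOn μ.cells 1) {n : ℕ} {r : ℕ}
    {b : BoxOf μ.cells} (hr : r < b.val.1) (T : Tab μ.cells n) :
    ∑ c ∈ insert b (rowBoxes μ.cells r), (tensR (Fin n → ℂ) X.kept n).mkQ
      (Phi1 X n (Finsupp.single (permAct (Equiv.swap b c) T) 1)) = 0 := by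
  have hsum : ∑ c ∈ insert b (rowBoxes μ.cells r), rowWord (permAct (Equiv.swap b c) T) =
      polarization n (some r) (some b.val.1) (word (Function.update
        (fun z : BoxOf μ.cells => (some z.val.1, T z)) b (some r, T b))) := by
    rw [polarization_word_update (ρ := fun z : BoxOf μ.cells => some z.val.1) (d := some b.val.1)
      T rfl]
    refine Finset.sum_congr ?_ fun c _ => ?_
    · congr 1
      ext z
      simp only [mem_rowBoxes, Finset.mem_filter, Finset.mem_univ, true_and, Option.some.injEq]
    · simp only [rowWord, permAct, Equiv.swap_inv]
  simp only [mkQ_Phi1_single]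
  rw [Finset.sum_comm]
  simp only [← map_sum, hsum]
  exact (isChainSystem_chainMap X n).sum_comp_eq_zero hr _

/-- The exchange relations imply all Garnir relations. -/
lemma sum_SA_eq_zero {K : Finset Cell} {n : ℕ} {Q : Type*} [AddCommGroup Q] [Module ℂ Q]
    {f : Tab K n → Q}
    (hf : ∀ (r : ℕ) (b : BoxOf K), r < b.val.1 → ∀ T,
      ∑ c ∈ insert b (rowBoxes K r), f (permAct (Equiv.swap b c) T) = 0)
    {r : ℕ} {A : Finset (BoxOf K)} (hA : ∀ x ∈ A, r ≤ x.val.1) (hcard : rowWidth K r < A.card)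
    (T : Tab K n) : ∑ σ ∈ SA A, f (permAct σ T) = 0 := by
  induction hk : (rowBoxes K r \ A).card using Nat.strong_induction_on generalizing A T with
  | _ k ih =>
  obtain ⟨b, hbA, hbr⟩ : ∃ b ∈ A, b ∉ rowBoxes K r := by
    refine Finset.exists_mem_notMem_of_card_lt_card ?_
    rwa [card_rowBoxes]
  rw [mem_rowBoxes] at hbr
  have hlt : r < b.val.1 := lt_of_le_of_ne (hA b hbA) (Ne.symm hbr)
  have hin : ∀ c ∈ A, ∑ σ ∈ SA A, f (permAct (Equiv.swap b c) (permAct σ T)) =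
      ∑ σ ∈ SA A, f (permAct σ T) := by
    intro c hc
    have hs := swap_mem_SA hbA hc
    refine Finset.sum_nbij' (Equiv.swap b c * ·) (Equiv.swap b c * ·)
      (fun σ hσ => SA_mul_mem hs hσ) (fun σ hσ => SA_mul_mem hs hσ) ?_ ?_ ?_
    · intro σ _
      rw [← mul_assoc, Equiv.swap_mul_self, one_mul]
    · intro σ _
      rw [← mul_assoc, Equiv.swap_mul_self, one_mul]
    · intro σ _
      rw [permAct_mul]
  have hout : ∀ c ∈ rowBoxes K r, c ∉ A →
      ∑ σ ∈ SA A, f (permAct (Equiv.swap b c) (permAct σ T)) = 0 := by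
    intro c hc hcA
    have hcb : c ≠ b := by rintro rfl; exact hcA hbA
    set A' := insert c (A.erase b) with hA'
    have hcA' : c ∉ A.erase b := fun h => hcA (Finset.mem_of_mem_erase h)
    have hbA' : b ∉ A' := by
      rw [hA', Finset.mem_insert, not_or]
      exact ⟨hcb.symm, Finset.notMem_erase b A⟩
    have hswap : ∀ x, x ∉ A' → Equiv.swap b c x ∉ A := by
      intro x hx
      by_cases hxb : x = b
      · rwa [hxb, Equiv.swap_apply_left]
      by_cases hxc : x = c
      · exact absurd (hxc ▸ Finset.mem_insert_self c _) hx
      rw [Equiv.swap_apply_of_ne_of_ne hxb hxc]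
      exact fun hxA => hx (Finset.mem_insert_of_mem (Finset.mem_erase.mpr ⟨hxb, hxA⟩))
    have hswap' : ∀ x, x ∉ A → Equiv.swap b c x ∉ A' := by
      intro x hx
      have hxb : x ≠ b := by rintro rfl; exact hx hbA
      by_cases hxc : x = c
      · rwa [hxc, Equiv.swap_apply_right]
      rw [Equiv.swap_apply_of_ne_of_ne hxb hxc, hA', Finset.mem_insert, not_or]
      exact ⟨hxc, fun h => hx (Finset.mem_of_mem_erase h)⟩
    have hcardA' : A'.card = A.card := by
      rw [hA', Finset.card_insert_of_notMem hcA', Finset.card_erase_add_one hbA]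
    have hless : (rowBoxes K r \ A').card < k := by
      rw [← hk]
      refine Finset.card_lt_card ⟨fun x hx => ?_, fun hsub => ?_⟩
      · rw [Finset.mem_sdiff] at hx ⊢
        refine ⟨hx.1, fun hxA => hx.2 (Finset.mem_insert_of_mem (Finset.mem_erase.mpr ⟨?_, hxA⟩))⟩
        rintro rfl
        exact hbr (mem_rowBoxes.mp hx.1)
      · exact (Finset.mem_sdiff.mp (hsub (Finset.mem_sdiff.mpr ⟨hc, hcA⟩))).2
          (Finset.mem_insert_self c _)
    rw [← ih _ hless (A := A') ?_ (by rwa [hcardA']) (permAct (Equiv.swap b c) T) rfl]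
    · refine Finset.sum_nbij' (fun σ => Equiv.swap b c * σ * Equiv.swap b c)
        (fun σ => Equiv.swap b c * σ * Equiv.swap b c) ?_ ?_ ?_ ?_ ?_
      · intro σ hσ
        refine mem_SA.mpr fun x hx => ?_
        rw [Equiv.Perm.mul_apply, Equiv.Perm.mul_apply, mem_SA.mp hσ _ (hswap x hx),
          Equiv.swap_apply_self]
      · intro σ hσ
        refine mem_SA.mpr fun x hx => ?_
        rw [Equiv.Perm.mul_apply, Equiv.Perm.mul_apply, mem_SA.mp hσ _ (hswap' x hx),
          Equiv.swap_apply_self]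
      · intro σ _
        simp [mul_assoc]
      · intro σ _
        simp [mul_assoc]
      · intro σ _
        rw [← permAct_mul, ← permAct_mul, mul_assoc _ (Equiv.swap b c), Equiv.swap_mul_self,
          mul_one]
    · intro x hx
      rcases Finset.mem_insert.mp hx with rfl | hx
      · exact (mem_rowBoxes.mp hc).ge
      · exact hA x (Finset.mem_of_mem_erase hx)
  have hzero : ∑ c ∈ insert b (rowBoxes K r),
      ∑ σ ∈ SA A, f (permAct (Equiv.swap b c) (permAct σ T)) = 0 := by
    rw [Finset.sum_comm]
    exact Finset.sum_eq_zero fun σ _ => hf r b hlt _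
  rw [← Finset.sum_filter_add_sum_filter_not _ (· ∈ A),
    Finset.sum_congr rfl fun c hc => hin c (Finset.mem_filter.mp hc).2, Finset.sum_const,
    Finset.sum_eq_zero (s := Finset.filter _ _) fun c hc => ?_, add_zero,
    ← Nat.cast_smul_eq_nsmul ℂ, smul_eq_zero, Nat.cast_eq_zero] at hzero
  · refine hzero.resolve_left (Finset.card_ne_zero_of_mem (a := b) ?_)
    exact Finset.mem_filter.mpr ⟨Finset.mem_insert_self b _, hbA⟩
  · rw [Finset.mem_filter, Finset.mem_insert] at hc
    exact hout c (hc.1.resolve_left fun h => hc.2 (h ▸ hbA)) hc.2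

lemma Phi1_mem_tensR {μ : YoungDiagram} (X : RemovalOn μ.cells 1) {n : ℕ}
    {v : FreeT μ.cells n} (hv : v ∈ Rmod μ.cells n) :
    Phi1 X n v ∈ tensR (Fin n → ℂ) X.kept n := by
  rw [← Submodule.Quotient.mk_eq_zero, ← Submodule.mkQ_apply]
  suffices h : Rmod μ.cells n ≤ LinearMap.ker
      ((tensR (Fin n → ℂ) X.kept n).mkQ.comp (Phi1 X n)) from h hv
  refine Submodule.span_le.mpr ?_
  rintro _ (⟨T₁, T₂, h, rfl⟩ | ⟨A, T, hA, rfl⟩)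
  · rw [SetLike.mem_coe, LinearMap.mem_ker, map_sub, LinearMap.comp_apply, LinearMap.comp_apply,
      mkQ_Phi1_single, mkQ_Phi1_single, rowWord_eq_of_rowEquiv h, sub_self]
  · rw [SetLike.mem_coe, LinearMap.mem_ker, garnir, map_sum]
    obtain ⟨a, ha, hmin⟩ := A.exists_min_image (fun x => x.val.1)
      (Finset.card_pos.mp ((Nat.zero_le _).trans_lt hA))
    refine sum_SA_eq_zero (r := a.val.1) (f := fun T => ((tensR (Fin n → ℂ) X.kept n).mkQ.comp
      (Phi1 X n)) (Finsupp.single T 1)) (fun r b hr T => sum_mkQ_Phi1_swap X hr T) hmin ?_ T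
    exact (Finset.le_sup (f := fun x : BoxOf μ.cells => rowWidth μ.cells x.val.1) ha).trans_lt hA

/-! ### Equivariance -/

lemma glAct_single (K : Finset Cell) {n : ℕ} (g : Matrix (Fin n) (Fin n) ℂ) (T : Tab K n) :
    glAct K n g (Finsupp.single T 1) =
      ∑ T' : Tab K n, (∏ x : BoxOf K, g (T' x) (T x)) • Finsupp.single T' (1 : ℂ) := by
  simp [glAct]

lemma mulVec_stdv {n : ℕ} (g : Matrix (Fin n) (Fin n) ℂ) (i : Fin n) :
    g.mulVec (stdv n i) = ∑ j, g j i • stdv n j := by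
  funext k
  simp [stdv, Finset.sum_apply, Pi.single_apply]

lemma sum_glAct_pact1 {K : Finset Cell} {X : RemovalOn K 1} {n : ℕ}
    (g : Matrix (Fin n) (Fin n) ℂ) (T : Tab K n) (P : MPath X) :
    ∑ T' : Tab K n, (∏ x, g (T' x) (T x)) • pact1 X T' P.map =
      TensorProduct.map (Matrix.mulVecLin g) (glAct X.kept n g) (pact1 X T P.map) := by
  rw [pact1_eq, TensorProduct.map_tmul, Matrix.mulVecLin_apply, mulVec_stdv, glAct_single,
    TensorProduct.sum_tmul, ← (Equiv.arrowCongr P.boxEquiv (Equiv.refl (Fin n))).sum_comp,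
    ← (Equiv.piOptionEquivProd (β := fun _ : Option (BoxOf X.kept) => Fin n)).symm.sum_comp,
    Fintype.sum_prod_type]
  refine Finset.sum_congr rfl fun j _ => ?_
  rw [TensorProduct.tmul_sum]
  refine Finset.sum_congr rfl fun T' _ => ?_
  rw [TensorProduct.smul_tmul_smul, pact1_eq, ← P.boxEquiv.prod_comp, Fintype.prod_option]
  simp [Equiv.arrowCongr, Equiv.piOptionEquivProd]

lemma Phi1_comp_glAct {K : Finset Cell} (X : RemovalOn K 1) (n : ℕ)
    (g : Matrix (Fin n) (Fin n) ℂ) :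
    (Phi1 X n).comp (glAct K n g) =
      (TensorProduct.map (Matrix.mulVecLin g) (glAct X.kept n g)).comp (Phi1 X n) := by
  refine Finsupp.lhom_ext' fun T => LinearMap.ext_ring ?_
  change Phi1 X n (glAct K n g (Finsupp.single T 1)) =
    TensorProduct.map (Matrix.mulVecLin g) (glAct X.kept n g) (Phi1 X n (Finsupp.single T 1))
  rw [glAct_single, Phi1_single, map_sum, map_sum]
  simp only [map_smul, Phi1_single, Finset.smul_sum]
  rw [Finset.sum_comm]
  refine Finset.sum_congr rfl fun P _ => ?_
  rw [← sum_glAct_pact1, Finset.smul_sum]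
  exact Finset.sum_congr rfl fun T' _ => smul_comm _ _ _

lemma map_mkQ_eq_zero_of_mem_tensR {K : Finset Cell} {n : ℕ}
    {z : (Fin n → ℂ) ⊗[ℂ] FreeT K n} (hz : z ∈ tensR (Fin n → ℂ) K n) :
    TensorProduct.map LinearMap.id (Rmod K n).mkQ z = 0 := by
  suffices h : tensR (Fin n → ℂ) K n ≤ LinearMap.ker
      (TensorProduct.map (LinearMap.id : (Fin n → ℂ) →ₗ[ℂ] _) (Rmod K n).mkQ) from h hz
  refine Submodule.span_le.mpr ?_
  rintro _ ⟨a, r, hr, rfl⟩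
  rw [SetLike.mem_coe, LinearMap.mem_ker, TensorProduct.map_tmul, Submodule.mkQ_apply,
    (Submodule.Quotient.mk_eq_zero _).mpr hr, TensorProduct.tmul_zero]

/-- The map `Φ₁ : ℱ_{λ,n} → V ⊗ ℱ_{λ∖X,n}` commutes with the
`GL_n(ℂ)`-actions and maps `R_{λ,n}` into `V ⊗ R_{λ∖X,n}`; hence it descends to a
(`GL_n(ℂ)`-equivariant) linear map `ℱ_{λ,n}/R_{λ,n} → V ⊗ (ℱ_{λ∖X,n}/R_{λ∖X,n})`,
i.e. a `GL_n(ℂ)`-map `S_λ(V) → V ⊗ S_{λ∖X}(V)`. -/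
theorem statement10 (μ : YoungDiagram) (n : ℕ) (X : RemovalOn μ.cells 1) :
    (∀ g : Matrix.GeneralLinearGroup (Fin n) ℂ,
        (Phi1 X n).comp (glAct μ.cells n g.val) =
          (TensorProduct.map (Matrix.mulVecLin g.val) (glAct X.kept n g.val)).comp
            (Phi1 X n)) ∧
    (∀ v ∈ Rmod μ.cells n, Phi1 X n v ∈ tensR (Fin n → ℂ) X.kept n) ∧
    ∃ Φbar : (FreeT μ.cells n ⧸ Rmod μ.cells n) →ₗ[ℂ]
        ((Fin n → ℂ) ⊗[ℂ] (FreeT X.kept n ⧸ Rmod X.kept n)),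
      ∀ v : FreeT μ.cells n,
        Φbar (Submodule.Quotient.mk v) =
          TensorProduct.map LinearMap.id (Rmod X.kept n).mkQ (Phi1 X n v) := by
  refine ⟨fun g => Phi1_comp_glAct X n g.val, fun v hv => Phi1_mem_tensR X hv, ?_⟩
  refine ⟨(Rmod μ.cells n).liftQ
    ((TensorProduct.map LinearMap.id (Rmod X.kept n).mkQ).comp (Phi1 X n)) fun v hv => ?_,
    fun v => rfl⟩
  exact map_mkQ_eq_zero_of_mem_tensR (Phi1_mem_tensR X hv)

end PieriPaper
end
end
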